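/- arXiv:1410.1911 — 4 statements merged into one kernel-verified Lean document; each statement's English description precedes it below -/
import Mathlib

section
/- For β ∈ (0,2), a > −1 and t > 0, the Green function satisfies the moment formula ∫_ℝ |x|^a · G_β(t,x) dx = (Γ(a+1) / Γ(aβ/2 + ⌈β⌉)) · t^{aβ/2 + ⌈β⌉ − 1}. In particular, taking a = 0, ∫_ℝ G_β(t,x) dx = t^{⌈β⌉−1}. -/
open MeasureTheory

/-- The two-parameter Mainardi function `M_{λ,μ}(z) = ∑ (−z)^n / (n! Γ(μ − (n+1)λ))`. -/
noncomputable def mainardiR (lam mu z : ℝ) : ℝ :=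
  ∑' n : ℕ, (-z) ^ n / ((n.factorial : ℝ) * Real.Gamma (mu - ((n : ℝ) + 1) * lam))

/-- The Green function `G_β(t,x) = (t^{⌈β⌉−1−β/2}/2) M_{β/2,⌈β⌉}(|x|/t^{β/2})`. -/
noncomputable def greenG (β t x : ℝ) : ℝ :=
  t ^ ((⌈β⌉₊ : ℝ) - 1 - β / 2) / 2 * mainardiR (β / 2) (⌈β⌉₊ : ℝ) (|x| / t ^ (β / 2))


namespace MW
open Filter Topology Set

lemma exp_arg_bound (κ : ℝ) (hκ : 0 < κ) (b z lam : ℝ) (h1 : lam < 1) :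
    ∀ᶠ x : ℝ in atTop, -κ * Real.exp x + b * x + z * Real.exp (lam * x) ≤ -1 * x := by
  have e1 : (fun x : ℝ => (b + 1) * x) =o[atTop] Real.exp := by
    have := (Real.isLittleO_pow_exp_atTop (n := 1)).const_mul_left (b + 1)
    simpa using this
  have e2 : (fun x : ℝ => z * Real.exp (lam * x)) =o[atTop] Real.exp := by
    refine Asymptotics.IsLittleO.const_mul_left ?_ z
    rw [Real.isLittleO_exp_comp_exp_comp]
    have : (fun x : ℝ => x - lam * x) = fun x => (1 - lam) * x := by ext; ring
    rw [this]
    exact tendsto_id.const_mul_atTop (by linarith)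
  have h := (e1.add e2).bound hκ
  filter_upwards [h] with x hx
  have := le_trans (le_abs_self _) hx
  rw [Real.norm_eq_abs, Real.abs_exp] at this
  linarith

lemma integrable_ray (κ : ℝ) (hκ : 0 < κ) (b z lam : ℝ) (h1 : lam < 1) :
    IntegrableOn (fun x : ℝ => Real.exp (-κ * Real.exp x + b * x + z * Real.exp (lam * x)))
      (Ioi 0) := by
  refine integrable_of_isBigO_exp_neg (b := 1) one_pos (by fun_prop) ?_
  refine Asymptotics.IsBigO.of_bound 1 ?_
  filter_upwards [exp_arg_bound κ hκ b z lam h1] with x hx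
  rw [Real.norm_eq_abs, Real.norm_eq_abs, Real.abs_exp, Real.abs_exp, one_mul]
  exact Real.exp_le_exp.mpr hx

lemma tendsto_ray (κ : ℝ) (hκ : 0 < κ) (b : ℝ) :
    Tendsto (fun x : ℝ => Real.exp (-κ * Real.exp x + b * x)) atTop (𝓝 0) := by
  have h0 : Tendsto (fun x : ℝ => Real.exp (-1 * x)) atTop (𝓝 0) := by
    simpa using Real.tendsto_exp_neg_atTop_nhds_zero
  refine tendsto_of_tendsto_of_tendsto_of_le_of_le' tendsto_const_nhds h0
    (Eventually.of_forall fun x => (Real.exp_pos _).le) ?_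
  filter_upwards [exp_arg_bound κ hκ b 0 0 one_pos] with x hx
  exact Real.exp_le_exp.mpr (by simpa using hx)

lemma integrable_line (κ : ℝ) (hκ : 0 < κ) (b : ℝ) (hb : 0 < b) :
    Integrable (fun x : ℝ => Real.exp (-κ * Real.exp x + b * x)) := by
  rw [← integrableOn_univ, ← Iic_union_Ioi (a := (0:ℝ)), integrableOn_union]
  constructor
  · refine (integrableOn_exp_mul_Iic hb 0).mono' (by fun_prop) (ae_of_all _ fun x => ?_)
    rw [Real.norm_eq_abs, Real.abs_exp]
    apply Real.exp_le_exp.mpr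
    have := mul_pos hκ (Real.exp_pos x)
    linarith
  · simpa using integrable_ray κ hκ b 0 0 one_pos

lemma integral_exp_change {E : Type*} [NormedAddCommGroup E] [NormedSpace ℝ E] (g : ℝ → E) :
    ∫ x in Ioi (0:ℝ), g x = ∫ x : ℝ, Real.exp x • g (Real.exp x) := by
  have := integral_image_eq_integral_abs_deriv_smul (s := univ) (f := Real.exp) (f' := Real.exp)
    MeasurableSet.univ (fun x _ => (Real.hasDerivAt_exp x).hasDerivWithinAt)
    Real.exp_injective.injOn g
  rw [image_univ, Real.range_exp] at this
  simpa using this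

lemma norm_E (s x y : ℝ) (ζ : ℂ) (h : ζ = x + y * Complex.I) :
    ‖Complex.exp (s * ζ - Complex.exp ζ)‖ = Real.exp (-Real.cos y * Real.exp x + s * x) := by
  subst h
  rw [Complex.norm_exp]
  simp [Complex.exp_re]
  ring

/-- log-coordinates Gamma, real line -/
lemma gamma_line (s : ℝ) (hs : 0 < s) :
    ∫ x : ℝ, Complex.exp (s * x - Complex.exp x) = (Real.Gamma s : ℂ) := by
  have h := integral_exp_change (fun r : ℝ => Real.exp (-r) * r ^ (s - 1))
  rw [← Real.Gamma_eq_integral hs] at h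
  rw [h, ← integral_complex_ofReal]
  congr 1; ext x
  rw [← Complex.ofReal_exp, ← Complex.ofReal_mul, ← Complex.ofReal_sub, ← Complex.ofReal_exp]
  congr 1
  rw [← Real.exp_mul, smul_eq_mul, ← Real.exp_add, ← Real.exp_add]
  ring_nf

lemma gamma_shift (s : ℝ) (hs : 0 < s) (θ : ℝ) (hθ : |θ| < Real.pi / 2) :
    ∫ x : ℝ, Complex.exp (s * (x + θ * Complex.I) - Complex.exp (x + θ * Complex.I))
      = (Real.Gamma s : ℂ) := by
  rw [← gamma_line s hs]
  set f : ℂ → ℂ := fun ζ => Complex.exp (s * ζ - Complex.exp ζ) with hf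
  have hfc : Continuous f := by rw [hf]; fun_prop
  have hfd : Differentiable ℂ f := by rw [hf]; fun_prop
  have hcos : 0 < Real.cos θ := Real.cos_pos_of_mem_Ioo ⟨by linarith [abs_lt.mp hθ], (abs_lt.mp hθ).2⟩
  have hcosy : ∀ y ∈ uIoc 0 θ, Real.cos θ ≤ Real.cos y := by
    intro y hy
    rw [← Real.cos_abs θ, ← Real.cos_abs y]
    have hy' : |y| ≤ |θ| := by
      rcases le_total 0 θ with h | h
      · rw [uIoc_of_le h] at hy
        rw [abs_of_nonneg h, abs_of_pos hy.1]; exact hy.2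
      · rw [uIoc_of_ge h] at hy
        rw [abs_of_nonpos h, abs_of_nonpos hy.2]; linarith [hy.1]
    exact Real.cos_le_cos_of_nonneg_of_le_pi (abs_nonneg _) (by linarith [Real.pi_pos]) hy'
  have hint : ∀ y : ℝ, 0 < Real.cos y → Integrable (fun x : ℝ => f (x + y * Complex.I)) := by
    intro y hy
    refine (integrable_line _ hy s hs).mono' (by fun_prop) (ae_of_all _ fun x => ?_)
    rw [hf]; exact (norm_E s x y _ rfl).le
  have hrect : ∀ T : ℝ, (∫ x in -T..T, f (x + θ * Complex.I)) = (∫ x in -T..T, f x)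
      + (Complex.I * (∫ y in (0:ℝ)..θ, f (T + y * Complex.I))
      - Complex.I * (∫ y in (0:ℝ)..θ, f ((-T : ℝ) + y * Complex.I))) := by
    intro T
    have := Complex.integral_boundary_rect_eq_zero_of_differentiableOn f ((-T : ℝ) : ℂ)
      (T + θ * Complex.I) hfd.differentiableOn
    simp at this
    simp
    linear_combination -this
  have hv : ∀ (g : ℝ → ℝ) , Tendsto (fun T => Real.exp (-Real.cos θ * Real.exp (g T) + s * g T)) atTop (𝓝 0) →
      Tendsto (fun T : ℝ => ∫ y in (0:ℝ)..θ, f ((g T : ℝ) + y * Complex.I)) atTop (𝓝 0) := by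
    intro g hg
    have hg2 := hg.mul_const |θ - 0|
    rw [zero_mul] at hg2
    refine squeeze_zero_norm (fun T => ?_) hg2
    refine intervalIntegral.norm_integral_le_of_norm_le_const fun y hy => ?_
    rw [hf]; dsimp only
    rw [norm_E s (g T) y _ rfl]
    apply Real.exp_le_exp.mpr
    have := mul_le_mul_of_nonneg_right (hcosy y hy) (Real.exp_pos (g T)).le
    linarith
  have v1 := hv (fun T => T) (tendsto_ray _ hcos s)
  have v2 := hv (fun T => -T) (by
    have h0 : Tendsto (fun T : ℝ => Real.exp (-(s * T))) atTop (𝓝 0) :=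
      Real.tendsto_exp_neg_atTop_nhds_zero.comp (tendsto_id.const_mul_atTop hs)
    refine squeeze_zero (fun T => (Real.exp_pos _).le) (fun T => ?_) h0
    apply Real.exp_le_exp.mpr
    have := mul_pos hcos (Real.exp_pos (-T))
    linarith)
  have l1 := intervalIntegral_tendsto_integral (hint θ hcos) tendsto_neg_atTop_atBot tendsto_id
  have l2 := intervalIntegral_tendsto_integral (f := fun x : ℝ => f x) (by simpa using hint 0 (by simp))
    tendsto_neg_atTop_atBot tendsto_id
  have l3 := l2.add ((v1.const_mul Complex.I).sub (v2.const_mul Complex.I))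
  simp only [mul_zero, sub_zero, add_zero] at l3
  exact tendsto_nhds_unique (l1.congr hrect) l3

lemma gamma_log (s : ℝ) (hs : 0 < s) (ζ : ℂ) (hζ : |ζ.im| < Real.pi / 2) :
    ∫ x : ℝ, Complex.exp (s * x - Complex.exp (x + ζ))
      = Complex.exp (-(s * ζ)) * (Real.Gamma s : ℂ) := by
  rw [← gamma_shift s hs ζ.im hζ, ← integral_const_mul,
    ← integral_add_right_eq_self (fun x : ℝ => Complex.exp (-(s * ζ)) *
      Complex.exp (s * (x + ζ.im * Complex.I) - Complex.exp (x + ζ.im * Complex.I))) ζ.re]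
  congr 1; ext x
  have : ((x + ζ.re : ℝ) : ℂ) + ζ.im * Complex.I = x + ζ := by
    conv_rhs => rw [← Complex.re_add_im ζ]
    push_cast; ring
  rw [this, ← Complex.exp_add]
  ring_nf

lemma gamma_mellin (a : ℝ) (ha : -1 < a) (ζ : ℂ) (hζ : |ζ.im| < Real.pi / 2) :
    ∫ z in Ioi (0:ℝ), ((z ^ a : ℝ) : ℂ) * Complex.exp (-(z * Complex.exp ζ))
      = Complex.exp (-((a + 1 : ℝ) * ζ)) * (Real.Gamma (a + 1) : ℂ) := by
  rw [integral_exp_change, ← gamma_log (a + 1) (by linarith) ζ hζ]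
  congr 1; ext x
  rw [← Real.exp_mul, Complex.real_smul, Complex.exp_add, sub_eq_add_neg,
    Complex.exp_add, ← mul_assoc, ← Complex.ofReal_mul, ← Real.exp_add]
  push_cast
  ring_nf


/-- the Hankel integrand in logarithmic coordinates -/
noncomputable def HF (v : ℝ) (ξ : ℂ) : ℂ := Complex.exp (Complex.exp ξ - v * ξ)

@[fun_prop] lemma HF_cont (v : ℝ) : Continuous (HF v) := by unfold HF; fun_prop
lemma HF_diff (v : ℝ) : Differentiable ℂ (HF v) := by unfold HF; fun_prop

lemma norm_HF (v x y : ℝ) :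
    ‖HF v (x + y * Complex.I)‖ = Real.exp (-(-Real.cos y) * Real.exp x + (-v) * x) := by
  rw [HF, Complex.norm_exp]
  simp [Complex.exp_re]
  ring

lemma HF_int (v y : ℝ) (hy : Real.cos y < 0) :
    IntegrableOn (fun x : ℝ => HF v (x + y * Complex.I)) (Ioi 0) := by
  have h := integrable_ray (-Real.cos y) (by linarith) (-v) 0 0 one_pos
  refine h.mono' (by fun_prop) (ae_of_all _ fun x => ?_)
  rw [norm_HF]; simp

noncomputable def HG (φ v : ℝ) : ℂ :=
  (∫ x in Ioi (0:ℝ), HF v (x + φ * Complex.I)) - (∫ x in Ioi (0:ℝ), HF v (x + (-φ : ℝ) * Complex.I))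
    + Complex.I * ∫ y in (-φ)..φ, HF v (y * Complex.I)

lemma HF_deriv (v : ℝ) (ξ : ℂ) : HasDerivAt (HF v) (HF (v - 1) ξ - v * HF v ξ) ξ := by
  have h : HasDerivAt (fun ξ : ℂ => Complex.exp ξ - v * ξ) (Complex.exp ξ - v * 1) ξ :=
    (Complex.hasDerivAt_exp ξ).sub ((hasDerivAt_id ξ).const_mul (v : ℂ))
  refine h.cexp.congr_deriv ?_
  have : HF (v - 1) ξ = Complex.exp ξ * Complex.exp (Complex.exp ξ - v * ξ) := by
    rw [HF, ← Complex.exp_add]; push_cast; ring_nf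
  rw [this, HF]; ring

lemma HF_ray_parts (v y : ℝ) (hy : Real.cos y < 0) :
    (∫ x in Ioi (0:ℝ), HF (v - 1) (x + y * Complex.I)) - v * (∫ x in Ioi (0:ℝ), HF v (x + y * Complex.I))
      = - HF v (y * Complex.I) := by
  rw [← integral_const_mul, ← integral_sub (HF_int _ y hy) ((HF_int _ y hy).const_mul _)]
  have hd : ∀ x ∈ Ici (0:ℝ), HasDerivAt (fun x : ℝ => HF v (x + y * Complex.I))
      (HF (v - 1) (x + y * Complex.I) - v * HF v (x + y * Complex.I)) x := by
    intro x _
    have h1 := (HF_deriv v (x + y * Complex.I)).comp (x : ℂ) ((hasDerivAt_id (x : ℂ)).add_const (y * Complex.I))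
    simpa using h1.comp_ofReal
  rw [integral_Ioi_of_hasDerivAt_of_tendsto' hd
    ((HF_int _ y hy).sub ((HF_int _ y hy).const_mul _)) (m := 0)]
  · simp
  · rw [tendsto_zero_iff_norm_tendsto_zero]
    simp_rw [norm_HF]
    exact tendsto_ray _ (by linarith) _

lemma HG_rec (φ v : ℝ) (hy : Real.cos φ < 0) : HG φ (v - 1) = v * HG φ v := by
  have h1 := HF_ray_parts v φ hy
  have h2 := HF_ray_parts v (-φ) (by simpa using hy)
  have h3 : (∫ y in (-φ)..φ, HF (v - 1) (y * Complex.I)) - v * (∫ y in (-φ)..φ, HF v (y * Complex.I))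
      = - Complex.I * (HF v (φ * Complex.I) - HF v ((-φ : ℝ) * Complex.I)) := by
    rw [← intervalIntegral.integral_const_mul, ← intervalIntegral.integral_sub
      (Continuous.intervalIntegrable (by fun_prop) _ _) (Continuous.intervalIntegrable (by fun_prop) _ _)]
    rw [intervalIntegral.integral_eq_sub_of_hasDerivAt (f := fun y : ℝ => - Complex.I * HF v (y * Complex.I))]
    · ring
    · intro x _
      have h1 := ((HF_deriv v (x * Complex.I)).comp (x : ℂ) ((hasDerivAt_id (x : ℂ)).mul_const Complex.I)).const_mul (-Complex.I)
      have h2 := h1.comp_ofReal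
      refine h2.congr_deriv ?_
      have := Complex.I_mul_I
      linear_combination -(HF (v - 1) (x * Complex.I) - v * HF v (x * Complex.I)) * this
    · exact Continuous.intervalIntegrable (by fun_prop) _ _
  unfold HG
  have := Complex.I_mul_I
  linear_combination h1 - h2 + Complex.I * h3 - (HF v (φ * Complex.I) - HF v ((-φ : ℝ) * Complex.I)) * this

lemma HG_neg (φ v : ℝ) (h1 : Real.pi / 2 < φ) (h2 : φ < Real.pi) (hv : v < 0) :
    HG φ v = 2 * Real.pi * Complex.I * ((Real.Gamma (v + 1))⁻¹ : ℝ) := by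
  have hcos : Real.cos φ < 0 := Real.cos_neg_of_pi_div_two_lt_of_lt h1 (by linarith)
  have hcos' : Real.cos (-φ) < 0 := by simpa using hcos
  -- integrability on Iic
  have hint : ∀ y : ℝ, Real.cos y < 0 → Integrable (fun x : ℝ => HF v (x + y * Complex.I)) := by
    intro y hy
    refine (integrable_line (-Real.cos y) (by linarith) (-v) (by linarith)).mono' (by fun_prop) (ae_of_all _ fun x => ?_)
    rw [norm_HF]
  have hrect : ∀ T : ℝ, (∫ x in T..0, HF v (x + φ * Complex.I)) - (∫ x in T..0, HF v (x + (-φ : ℝ) * Complex.I))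
      + Complex.I * (∫ y in (-φ)..φ, HF v (T + y * Complex.I))
      = Complex.I * ∫ y in (-φ)..φ, HF v (y * Complex.I) := by
    intro T
    have := Complex.integral_boundary_rect_eq_zero_of_differentiableOn (HF v) (T + (-φ : ℝ) * Complex.I)
      (φ * Complex.I) (HF_diff v).differentiableOn
    simp at this
    simp
    linear_combination -this
  have hvt : Tendsto (fun T : ℝ => ∫ y in (-φ)..φ, HF v (T + y * Complex.I)) atBot (𝓝 0) := by
    have hlim : Tendsto (fun T : ℝ => Real.exp (1 * Real.exp T + -v * T) * |φ - -φ|) atBot (𝓝 0) := by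
      have e1 : Tendsto (fun T : ℝ => 1 * Real.exp T + -v * T) atBot atBot := by
        apply Tendsto.add_atBot (C := 1 * 0)
        · exact Real.tendsto_exp_atBot.const_mul _
        · exact tendsto_id.const_mul_atBot (by linarith)
      simpa using (Real.tendsto_exp_atBot.comp e1).mul_const |φ - -φ|
    refine squeeze_zero_norm (fun T => ?_) hlim
    refine intervalIntegral.norm_integral_le_of_norm_le_const fun y hy => ?_
    rw [norm_HF]
    apply Real.exp_le_exp.mpr
    have := mul_le_mul_of_nonneg_right (Real.cos_le_one y) (Real.exp_pos T).le
    linarith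
  have l1 := intervalIntegral_tendsto_integral_Iic 0 (hint φ hcos).integrableOn tendsto_id
  have l2 := intervalIntegral_tendsto_integral_Iic 0 (hint (-φ) hcos').integrableOn tendsto_id
  have l3 := (l1.sub l2).add (hvt.const_mul Complex.I)
  have l4 := tendsto_nhds_unique (l3.congr hrect) tendsto_const_nhds
  have split : ∀ y : ℝ, Real.cos y < 0 → (∫ x in Iic (0:ℝ), HF v (x + y * Complex.I)) + (∫ x in Ioi (0:ℝ), HF v (x + y * Complex.I))
      = ∫ x : ℝ, HF v (x + y * Complex.I) := fun y hy =>
    intervalIntegral.integral_Iic_add_Ioi (hint y hy).integrableOn (hint y hy).integrableOn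
  have s1 := split φ hcos
  have s2 := split (-φ) hcos'
  have key : ∀ y σ : ℝ, (Complex.exp (σ * Complex.I) = -1) → |y - σ| < Real.pi / 2 →
      ∫ x : ℝ, HF v (x + y * Complex.I) = Complex.exp (((-v) * σ : ℝ) * Complex.I) * (Real.Gamma (-v) : ℂ) := by
    intro y σ hσ hy
    have := gamma_log (-v) (by linarith) ((y - σ : ℝ) * Complex.I) (by simpa using hy)
    have h3 : ∀ x : ℝ, HF v (x + y * Complex.I) = Complex.exp (((-v) * y : ℝ) * Complex.I)
        * Complex.exp ((-v : ℝ) * x - Complex.exp (x + (y - σ : ℝ) * Complex.I)) := by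
      intro x
      rw [HF, ← Complex.exp_add]
      have : Complex.exp (x + y * Complex.I) = - Complex.exp (x + (y - σ : ℝ) * Complex.I) := by
        have h4 : (x : ℂ) + y * Complex.I = (x + (y - σ : ℝ) * Complex.I) + σ * Complex.I := by
          push_cast; ring
        rw [h4, Complex.exp_add, hσ]; ring
      rw [this]; push_cast; ring_nf
    simp_rw [h3]
    rw [integral_const_mul, this, ← mul_assoc, ← Complex.exp_add]
    push_cast; ring_nf
  have k1 := key φ Real.pi Complex.exp_pi_mul_I (by rw [abs_lt]; constructor <;> linarith)
  have k2 := key (-φ) (-Real.pi) (by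
    rw [Complex.ofReal_neg, neg_mul, Complex.exp_neg, Complex.exp_pi_mul_I]; norm_num)
    (by rw [abs_lt]; constructor <;> linarith)
  have tot : HG φ v = (∫ x : ℝ, HF v (x + φ * Complex.I)) - ∫ x : ℝ, HF v (x + (-φ : ℝ) * Complex.I) := by
    rw [HG, ← l4, ← s1, ← s2]; ring
  rw [tot, k1, k2]
  have hrefl := Real.Gamma_mul_Gamma_one_sub (-v)
  have hsin : Complex.exp (((-v) * Real.pi : ℝ) * Complex.I) - Complex.exp (((-v) * (-Real.pi) : ℝ) * Complex.I)
      = 2 * Complex.I * (Real.sin (Real.pi * (-v)) : ℝ) := by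
    rw [Complex.ofReal_sin, Complex.sin]
    have := Complex.I_mul_I
    push_cast
    ring_nf
    simp
    ring_nf
  rw [← sub_mul, hsin]
  have hre : Real.sin (Real.pi * (-v)) * Real.Gamma (-v) = Real.pi * (Real.Gamma (v + 1))⁻¹ := by
    rw [show (1 - -v) = v + 1 by ring] at hrefl
    have hG : 0 < Real.Gamma (-v) := Real.Gamma_pos_of_pos (by linarith)
    by_cases hs : Real.sin (Real.pi * (-v)) = 0
    · rw [hs, div_zero] at hrefl
      have : Real.Gamma (v + 1) = 0 := by
        rcases mul_eq_zero.mp hrefl with h | h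
        · exact absurd h hG.ne'
        · exact h
      rw [hs, this]; simp
    · have : Real.Gamma (v + 1) ≠ 0 := by
        intro h
        rw [h, mul_zero] at hrefl
        exact (div_ne_zero Real.pi_ne_zero hs) hrefl.symm
      rw [eq_div_iff hs] at hrefl
      rw [eq_mul_inv_iff_mul_eq₀ this]
      linarith
  have hre' : ((Real.sin (Real.pi * (-v)) : ℝ) : ℂ) * (Real.Gamma (-v) : ℂ) = Real.pi * ((Real.Gamma (v + 1))⁻¹ : ℝ) := by
    rw [← Complex.ofReal_mul, hre]; push_cast; ring
  linear_combination 2 * Complex.I * hre'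

lemma HG_cont0 (φ : ℝ) (hcos : Real.cos φ < 0) : ContinuousAt (HG φ) 0 := by
  have hc : ∀ ξ : ℂ, Continuous (fun v : ℝ => HF v ξ) := by intro ξ; unfold HF; fun_prop
  have hev : ∀ᶠ v : ℝ in 𝓝 0, -1 ≤ v ∧ v ≤ 1 := by
    filter_upwards [Icc_mem_nhds (show (-1:ℝ) < 0 by norm_num) (show (0:ℝ) < 1 by norm_num)] with v hv using hv
  have hray : ∀ y : ℝ, Real.cos y < 0 → ContinuousAt (fun v : ℝ => ∫ x in Ioi (0:ℝ), HF v (x + y * Complex.I)) 0 := by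
    intro y hy
    refine continuousAt_of_dominated (bound := fun x => ‖HF (-1) (x + y * Complex.I)‖)
      (Eventually.of_forall fun v => by fun_prop) ?_ (HF_int _ y hy).norm
      (ae_of_all _ fun x => (hc _).continuousAt)
    filter_upwards [hev] with v hv
    refine (ae_restrict_iff' measurableSet_Ioi).mpr (ae_of_all _ fun x hx => ?_)
    rw [norm_HF, norm_HF]
    apply Real.exp_le_exp.mpr
    have hx' : 0 < x := hx
    nlinarith [hv.1]
  have harc : ContinuousAt (fun v : ℝ => ∫ y in (-φ)..φ, HF v (y * Complex.I)) 0 := by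
    apply Continuous.continuousAt
    refine intervalIntegral.continuous_parametric_intervalIntegral_of_continuous' ?_ _ _
    unfold Function.uncurry HF; fun_prop
  exact ((hray φ hcos).sub (hray (-φ) (by simpa using hcos))).add (continuousAt_const.mul harc)

lemma HG_all (φ v : ℝ) (h1 : Real.pi / 2 < φ) (h2 : φ < Real.pi) :
    HG φ v = 2 * Real.pi * Complex.I * ((Real.Gamma (v + 1))⁻¹ : ℝ) := by
  have hcos : Real.cos φ < 0 := Real.cos_neg_of_pi_div_two_lt_of_lt h1 (by linarith)
  have h0 : HG φ 0 = 2 * Real.pi * Complex.I * ((Real.Gamma (0 + 1))⁻¹ : ℝ) := by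
    have c1 := (HG_cont0 φ hcos).tendsto.mono_left (nhdsWithin_le_nhds (s := Iio 0))
    have c2 : Tendsto (fun v : ℝ => 2 * Real.pi * Complex.I * (((Real.Gamma (v + 1))⁻¹ : ℝ) : ℂ)) (𝓝[<] 0)
        (𝓝 (2 * Real.pi * Complex.I * ((Real.Gamma (0 + 1))⁻¹ : ℝ))) := by
      have d : ContinuousAt (fun v : ℝ => (Real.Gamma (v + 1))⁻¹) 0 := by
        apply ContinuousAt.inv₀
        · apply ContinuousAt.comp (g := Real.Gamma) (f := fun v : ℝ => v + 1)
          · apply DifferentiableAt.continuousAt (𝕜 := ℝ)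
            apply Real.differentiableAt_Gamma
            intro m
            have : (0:ℝ) ≤ m := m.cast_nonneg
            linarith
          · fun_prop
        · simp
      have d2 : ContinuousAt (fun v : ℝ => 2 * Real.pi * Complex.I * (((Real.Gamma (v + 1))⁻¹ : ℝ) : ℂ)) 0 :=
        continuousAt_const.mul (Complex.continuous_ofReal.continuousAt.comp d)
      exact d2.tendsto.mono_left nhdsWithin_le_nhds
    refine tendsto_nhds_unique c1 (c2.congr' ?_)
    filter_upwards [self_mem_nhdsWithin] with v hv
    exact (HG_neg φ v h1 h2 hv).symm
  have hind : ∀ n : ℕ, ∀ v : ℝ, v < n → HG φ v = 2 * Real.pi * Complex.I * ((Real.Gamma (v + 1))⁻¹ : ℝ) := by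
    intro n
    induction n with
    | zero => intro v hv; exact HG_neg φ v h1 h2 (by simpa using hv)
    | succ n ih =>
      intro v hv
      rcases lt_trichotomy v 0 with h | h | h
      · exact HG_neg φ v h1 h2 h
      · rw [h]; exact h0
      · have hr := HG_rec φ v hcos
        rw [ih (v - 1) (by push_cast at hv; linarith), sub_add_cancel] at hr
        have hvne : (v : ℂ) ≠ 0 := by exact_mod_cast h.ne'
        have hG := (Real.Gamma_pos_of_pos h).ne'
        rw [Real.Gamma_add_one h.ne']
        apply mul_left_cancel₀ hvne
        rw [← hr]
        push_cast
        have : (Real.Gamma v : ℂ) ≠ 0 := by exact_mod_cast hG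
        field_simp
  obtain ⟨n, hn⟩ := exists_nat_gt v
  exact hind n v hn

def Good (lam mu a : ℝ) (h : ℝ → ℂ) : Prop := ∃ m : ℝ → ℂ,
  (∀ z : ℝ, HasSum (fun n : ℕ => (((-z) ^ n / (n.factorial : ℝ) : ℝ) : ℂ) * h (mu - ((n : ℝ) + 1) * lam)) (m z)) ∧
  IntegrableOn (fun z : ℝ => ((z ^ a : ℝ) : ℂ) * m z) (Ioi 0) ∧
  ∫ z in Ioi (0:ℝ), ((z ^ a : ℝ) : ℂ) * m z = (Real.Gamma (a + 1) : ℂ) * h (mu + lam * a)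

lemma Good.add {lam mu a : ℝ} {h₁ h₂ : ℝ → ℂ} (H₁ : Good lam mu a h₁) (H₂ : Good lam mu a h₂) :
    Good lam mu a (fun w => h₁ w + h₂ w) := by
  obtain ⟨m₁, s₁, i₁, e₁⟩ := H₁
  obtain ⟨m₂, s₂, i₂, e₂⟩ := H₂
  refine ⟨fun z => m₁ z + m₂ z, fun z => ?_, ?_, ?_⟩
  · simp_rw [mul_add]; exact (s₁ z).add (s₂ z)
  · simp_rw [mul_add]; exact i₁.add i₂
  · simp_rw [mul_add]; rw [integral_add i₁ i₂, e₁, e₂]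

lemma Good.const {lam mu a : ℝ} {h₁ : ℝ → ℂ} (c : ℂ) (H₁ : Good lam mu a h₁) :
    Good lam mu a (fun w => c * h₁ w) := by
  obtain ⟨m₁, s₁, i₁, e₁⟩ := H₁
  refine ⟨fun z => c * m₁ z, fun z => ?_, ?_, ?_⟩
  · have h := (s₁ z).mul_left c
    simp_rw [mul_left_comm c] at h
    exact h
  · exact (Integrable.const_mul i₁ c).congr (ae_of_all _ fun z => by dsimp only; ring)
  · rw [mul_left_comm, ← e₁, ← integral_const_mul]; congr 1; ext z; ring

lemma piece (lam mu a θ : ℝ) (hl : 0 < lam) (ha : -1 < a) (hθ : θ < Real.pi / 2)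
    (ν : Measure ℝ) [SFinite ν] (g X : ℝ → ℂ) (hg : Continuous g) (hX : Continuous X)
    (hre : ∀ᵐ u ∂ν, 0 ≤ (X u).re) (him : ∀ᵐ u ∂ν, |lam * (X u).im| ≤ θ)
    (hint : ∀ b z : ℝ, Integrable (fun u => ‖g u‖ * Real.exp (b * (X u).re + z * Real.exp (lam * (X u).re))) ν) :
    Good lam mu a (fun w => ∫ u, g u * Complex.exp (-(w * X u)) ∂ν) := by
  refine ⟨fun z => ∫ u, g u * Complex.exp ((lam - mu : ℝ) * X u) * Complex.exp (-(z * Complex.exp (lam * X u))) ∂ν,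
    fun z => ?_, ?_⟩
  · have hbs : ∀ u, HasSum (fun n : ℕ => ‖g u‖ * Real.exp ((lam - mu) * (X u).re) *
        ((|z| * Real.exp (lam * (X u).re)) ^ n / (n.factorial : ℝ)))
        (‖g u‖ * Real.exp ((lam - mu) * (X u).re + |z| * Real.exp (lam * (X u).re))) := by
      intro u
      have := (NormedSpace.expSeries_div_hasSum_exp (𝔸 := ℝ) (|z| * Real.exp (lam * (X u).re))).mul_left
        (‖g u‖ * Real.exp ((lam - mu) * (X u).re))
      rw [← Real.exp_eq_exp_ℝ] at this
      rwa [Real.exp_add, ← mul_assoc]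
    have := hasSum_integral_of_dominated_convergence (μ := ν)
      (F := fun (n : ℕ) u => g u * Complex.exp ((lam - mu : ℝ) * X u) * ((-(z * Complex.exp (lam * X u))) ^ n / (n.factorial : ℂ)))
      (f := fun u => g u * Complex.exp ((lam - mu : ℝ) * X u) * Complex.exp (-(z * Complex.exp (lam * X u))))
      (fun n u => ‖g u‖ * Real.exp ((lam - mu) * (X u).re) *
        ((|z| * Real.exp (lam * (X u).re)) ^ n / (n.factorial : ℝ)))
      (fun n => by fun_prop) (fun n => ae_of_all _ fun u => ?_)
      (ae_of_all _ fun u => (hbs u).summable) ?_ (ae_of_all _ fun u => ?_)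
    · refine (congrArg (fun F : ℕ → ℂ => HasSum F _) (funext fun n => ?_)).mpr this
      rw [← integral_const_mul]
      congr 1; ext u
      rw [neg_mul_eq_neg_mul (z : ℂ), mul_pow, ← Complex.exp_nat_mul]
      have e : Complex.exp (-((mu - ((n:ℝ) + 1) * lam : ℝ) * X u)) =
          Complex.exp ((lam - mu : ℝ) * X u) * Complex.exp (n * (lam * X u)) := by
        rw [← Complex.exp_add]; push_cast; ring_nf
      rw [e]; push_cast; ring
    · refine le_of_eq ?_
      simp only [norm_mul, norm_div, norm_pow, norm_neg, Complex.norm_exp, Complex.norm_real, Complex.norm_natCast,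
        Complex.re_ofReal_mul, Real.norm_eq_abs]
    · simp_rw [fun u => (hbs u).tsum_eq]
      exact hint _ _
    · have := (NormedSpace.expSeries_div_hasSum_exp (𝔸 := ℂ) (-(z * Complex.exp (lam * X u)))).mul_left
        (g u * Complex.exp ((lam - mu : ℝ) * X u))
      rwa [← Complex.exp_eq_exp_ℂ] at this
  · set c := Real.cos θ with hc
    set f : ℝ → ℝ → ℂ := fun z u => ((z ^ a : ℝ) : ℂ) * (g u * Complex.exp ((lam - mu : ℝ) * X u) *
      Complex.exp (-(z * Complex.exp (lam * X u)))) with hf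
    by_cases hν : ν = 0
    · subst hν; simp
    have hθ0 : 0 ≤ θ := by
      have : NeZero ν := ⟨hν⟩
      obtain ⟨u, hu⟩ := him.exists
      exact (abs_nonneg _).trans hu
    have hcpos : 0 < c := Real.cos_pos_of_mem_Ioo ⟨by linarith [Real.pi_pos], hθ⟩
    have hreexp : ∀ᵐ u ∂ν, c ≤ (Complex.exp (lam * X u)).re := by
      filter_upwards [hre, him] with u h1 h2
      rw [Complex.exp_re, Complex.re_ofReal_mul, Complex.im_ofReal_mul]
      have e1 : 1 ≤ Real.exp (lam * (X u).re) := Real.one_le_exp (by positivity)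
      have e2 : c ≤ Real.cos (lam * (X u).im) := by
        rw [hc, ← Real.cos_abs (lam * (X u).im)]
        exact Real.cos_le_cos_of_nonneg_of_le_pi (abs_nonneg _) (by linarith [Real.pi_pos]) h2
      nlinarith
    have hI : Integrable (Function.uncurry f) ((volume.restrict (Ioi 0)).prod ν) := by
      have hA : Integrable (fun z : ℝ => z ^ a * Real.exp (-c * z)) (volume.restrict (Ioi 0)) := by
        have := integrableOn_rpow_mul_exp_neg_mul_rpow (p := 1) ha one_pos hcpos
        simp only [Real.rpow_one] at this
        exact this
      have hB : Integrable (fun u => ‖g u‖ * Real.exp ((lam - mu) * (X u).re)) ν := by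
        simpa using hint (lam - mu) 0
      refine (hA.mul_prod hB).mono' ?_ ?_
      · rw [hf]; unfold Function.uncurry
        apply Measurable.aestronglyMeasurable
        have := hg.measurable
        have := hX.measurable
        fun_prop
      · have q1 : ∀ᵐ p : ℝ × ℝ ∂((volume.restrict (Ioi 0)).prod ν), p.1 ∈ Ioi (0:ℝ) :=
          Measure.quasiMeasurePreserving_fst.ae (ae_restrict_mem measurableSet_Ioi)
        have q2 : ∀ᵐ p : ℝ × ℝ ∂((volume.restrict (Ioi 0)).prod ν), c ≤ (Complex.exp (lam * X p.2)).re :=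
          Measure.quasiMeasurePreserving_snd.ae hreexp
        filter_upwards [q1, q2] with p h1 h2
        have h1' : 0 < p.1 := h1
        simp only [Function.uncurry, hf, norm_mul, Complex.norm_exp, Complex.norm_real, Complex.re_ofReal_mul,
          Complex.neg_re, Real.norm_eq_abs]
        rw [abs_of_pos (Real.rpow_pos_of_pos h1' a)]
        have e : Real.exp (-(p.1 * (Complex.exp (lam * X p.2)).re)) ≤ Real.exp (-c * p.1) :=
          Real.exp_le_exp.mpr (by nlinarith)
        have e2 := mul_le_mul_of_nonneg_left e
          (show 0 ≤ p.1 ^ a * (‖g p.2‖ * Real.exp ((lam - mu) * (X p.2).re)) by positivity)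
        linarith
    have hsw := integral_integral_swap hI
    have hfe : ∀ z, ((z ^ a : ℝ) : ℂ) * (∫ u, g u * Complex.exp ((lam - mu : ℝ) * X u) *
        Complex.exp (-(z * Complex.exp (lam * X u))) ∂ν) = ∫ u, f z u ∂ν := by
      intro z; rw [hf]; dsimp only; rw [integral_const_mul]
    simp_rw [hfe]
    refine ⟨hI.integral_prod_left, ?_⟩
    rw [hsw, ← integral_const_mul]
    refine integral_congr_ae ?_
    filter_upwards [him] with u hu
    have := gamma_mellin a ha (lam * X u) (by rw [Complex.im_ofReal_mul]; linarith)
    have e : ∀ z : ℝ, f z u = g u * Complex.exp ((lam - mu : ℝ) * X u) *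
      (((z ^ a : ℝ) : ℂ) * Complex.exp (-(z * Complex.exp (lam * X u)))) := by
      intro z; rw [hf]; ring
    simp_rw [e]
    rw [integral_const_mul, this]
    have e3 : Complex.exp (-((mu + lam * a : ℝ) * X u)) = Complex.exp ((lam - mu : ℝ) * X u) *
        Complex.exp (-((a + 1 : ℝ) * (lam * X u))) := by
      rw [← Complex.exp_add]; push_cast; ring_nf
    rw [e3]; ring

lemma ray_good (lam mu a φ : ℝ) (hl : 0 < lam) (hl1 : lam < 1) (ha : -1 < a) (hcos : Real.cos φ < 0)
    (hφ : |lam * φ| < Real.pi / 2) :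
    Good lam mu a (fun w => ∫ x in Ioi (0:ℝ), HF (w - 1) (x + φ * Complex.I)) := by
  have := piece lam mu a |lam * φ| hl ha hφ (volume.restrict (Ioi 0))
    (fun x => HF (-1) (x + φ * Complex.I)) (fun x => x + φ * Complex.I) (by fun_prop) (by fun_prop)
    (by filter_upwards [ae_restrict_mem measurableSet_Ioi] with x hx
        have : (0:ℝ) < x := hx
        simpa using this.le)
    (ae_of_all _ fun x => by simp) (by
      intro b z
      have := integrable_ray (-Real.cos φ) (by linarith) (1 + b) z lam hl1
      refine this.congr (ae_of_all _ fun x => ?_)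
      simp only [norm_HF, ← Real.exp_add]
      congr 1
      simp
      ring)
  refine Eq.mp (congrArg _ (funext fun w => ?_)) this
  congr 1; ext x
  rw [HF, HF, ← Complex.exp_add]; push_cast; ring_nf

lemma arc_good (lam mu a φ : ℝ) (hl : 0 < lam) (ha : -1 < a) (h0 : 0 < φ)
    (hφ : lam * φ < Real.pi / 2) :
    Good lam mu a (fun w => ∫ y in (-φ)..φ, HF (w - 1) (y * Complex.I)) := by
  have := piece lam mu a (lam * φ) hl ha hφ (volume.restrict (Ioc (-φ) φ))
    (fun x => HF (-1) (x * Complex.I)) (fun x => x * Complex.I) (by fun_prop) (by fun_prop)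
    (ae_of_all _ fun x => by simp)
    (by filter_upwards [ae_restrict_mem measurableSet_Ioc] with x hx
        have : |x| ≤ φ := abs_le.mpr ⟨hx.1.le, hx.2⟩
        simp only [Complex.mul_im, Complex.ofReal_re, Complex.ofReal_im, Complex.I_re, Complex.I_im]
        rw [abs_mul, abs_of_pos hl]
        simpa using mul_le_mul_of_nonneg_left this hl.le) (by
      intro b z
      apply Continuous.integrableOn_Ioc
      fun_prop)
  convert this using 2 with w
  rw [intervalIntegral.integral_of_le (by linarith)]
  congr 1; ext x
  rw [HF, HF, ← Complex.exp_add]; push_cast; ring_nf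

lemma gamma_good (lam mu a : ℝ) (hl : 0 < lam) (hl1 : lam < 1) (ha : -1 < a) :
    Good lam mu a (fun w => ((Real.Gamma w)⁻¹ : ℝ)) := by
  have hpi := Real.pi_pos
  obtain ⟨φ, h1, h2⟩ : ∃ φ, Real.pi / 2 < φ ∧ φ < min Real.pi (Real.pi / 2 / lam) := by
    apply exists_between
    refine lt_min (by linarith) ?_
    rw [lt_div_iff₀ hl]
    nlinarith
  have h3 : φ < Real.pi := lt_of_lt_of_le h2 (min_le_left _ _)
  have h4 : lam * φ < Real.pi / 2 := by
    have := lt_of_lt_of_le h2 (min_le_right _ _)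
    rw [lt_div_iff₀ hl] at this
    linarith
  have h0 : 0 < φ := by linarith
  have hcos : Real.cos φ < 0 := Real.cos_neg_of_pi_div_two_lt_of_lt h1 (by linarith)
  have g1 := ray_good lam mu a φ hl hl1 ha hcos (by rw [abs_of_pos (by positivity)]; exact h4)
  have g2 := ray_good lam mu a (-φ) hl hl1 ha (by simpa using hcos)
    (by rw [mul_neg, abs_neg, abs_of_pos (by positivity)]; exact h4)
  have g3 := arc_good lam mu a φ hl ha h0 h4
  have G := ((g1.add (g2.const (-1))).add (g3.const Complex.I)).const (2 * Real.pi * Complex.I)⁻¹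
  convert G using 2 with w
  have := HG_all φ (w - 1) h1 h3
  rw [sub_add_cancel, HG] at this
  have hne : (2 * Real.pi * Complex.I : ℂ) ≠ 0 := Complex.two_pi_I_ne_zero
  rw [eq_inv_mul_iff_mul_eq₀ hne, ← this]
  ring

end MW
lemma mainardi_mellin (lam mu a : ℝ) (hl : 0 < lam) (hl1 : lam < 1) (ha : -1 < a) :
    ∫ z in Set.Ioi (0:ℝ), z ^ a * mainardiR lam mu z = Real.Gamma (a + 1) / Real.Gamma (mu + lam * a) := by
  obtain ⟨m, hs, -, he⟩ := MW.gamma_good lam mu a hl hl1 ha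
  have hm : ∀ z, m z = (mainardiR lam mu z : ℂ) := by
    intro z
    rw [← (hs z).tsum_eq, mainardiR, Complex.ofReal_tsum]
    congr 1; ext n
    rw [← Complex.ofReal_mul]; congr 1
    rw [← div_div, div_eq_mul_inv _ (Real.Gamma _)]
  simp_rw [hm, ← Complex.ofReal_mul] at he
  rw [integral_complex_ofReal] at he
  rw [div_eq_mul_inv]
  exact_mod_cast he

lemma greenG_moment_aux (β : ℝ) (hβ0 : 0 < β) (hβ2 : β < 2)
    (a : ℝ) (ha : -1 < a) (t : ℝ) (ht : 0 < t) :
    ∫ x : ℝ, |x| ^ a * greenG β t x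
      = Real.Gamma (a + 1) / Real.Gamma (a * β / 2 + (⌈β⌉₊ : ℝ))
          * t ^ (a * β / 2 + (⌈β⌉₊ : ℝ) - 1) := by
  have hT : 0 < t ^ (β / 2) := Real.rpow_pos_of_pos ht _
  have hM := mainardi_mellin (β / 2) (⌈β⌉₊ : ℝ) a (by linarith) (by linarith) ha
  have h1 := integral_comp_abs (f := fun x => x ^ a * (t ^ ((⌈β⌉₊ : ℝ) - 1 - β / 2) / 2 *
    mainardiR (β / 2) (⌈β⌉₊ : ℝ) (x / t ^ (β / 2))))
  unfold greenG
  rw [h1]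
  have h2 := integral_comp_mul_left_Ioi (fun z => z ^ a * mainardiR (β / 2) (⌈β⌉₊ : ℝ) z) 0 (inv_pos.mpr hT)
  rw [mul_zero, hM, inv_inv, smul_eq_mul] at h2
  have h3 : ∫ x in Set.Ioi (0:ℝ), x ^ a * (t ^ ((⌈β⌉₊ : ℝ) - 1 - β / 2) / 2 *
      mainardiR (β / 2) (⌈β⌉₊ : ℝ) (x / t ^ (β / 2)))
      = ∫ x in Set.Ioi (0:ℝ), (t ^ ((⌈β⌉₊ : ℝ) - 1 - β / 2) / 2 * (t ^ (β / 2)) ^ a) *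
        (((t ^ (β / 2))⁻¹ * x) ^ a * mainardiR (β / 2) (⌈β⌉₊ : ℝ) ((t ^ (β / 2))⁻¹ * x)) := by
    refine setIntegral_congr_fun measurableSet_Ioi fun x hx => ?_
    have hx' : (0:ℝ) < x := hx
    rw [Real.mul_rpow (inv_pos.mpr hT).le hx'.le, Real.inv_rpow hT.le, div_eq_inv_mul x]
    have := (Real.rpow_pos_of_pos hT a).ne'
    field_simp
  rw [h3, integral_const_mul, h2]
  have e : t ^ (a * β / 2 + (⌈β⌉₊ : ℝ) - 1) = t ^ ((⌈β⌉₊ : ℝ) - 1 - β / 2) * (t ^ (β / 2)) ^ a * t ^ (β / 2) := by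
    rw [← Real.rpow_mul ht.le, ← Real.rpow_add ht, ← Real.rpow_add ht]
    ring_nf
  rw [e, show (⌈β⌉₊ : ℝ) + β / 2 * a = a * β / 2 + (⌈β⌉₊ : ℝ) by ring]
  ring

/-- the moment formula
`∫_ℝ |x|^a G_β(t,x) dx = (Γ(a+1)/Γ(aβ/2 + ⌈β⌉)) t^{aβ/2 + ⌈β⌉ − 1}`
for `β ∈ (0,2)`, `a > −1`, `t > 0`; in particular `∫_ℝ G_β(t,x) dx = t^{⌈β⌉−1}`. -/
theorem greenG_moment (β : ℝ) (hβ0 : 0 < β) (hβ2 : β < 2)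
    (a : ℝ) (ha : -1 < a) (t : ℝ) (ht : 0 < t) :
    (∫ x : ℝ, |x| ^ a * greenG β t x
      = Real.Gamma (a + 1) / Real.Gamma (a * β / 2 + (⌈β⌉₊ : ℝ))
          * t ^ (a * β / 2 + (⌈β⌉₊ : ℝ) - 1)) ∧
    (∫ x : ℝ, greenG β t x = t ^ ((⌈β⌉₊ : ℝ) - 1)) := by
  refine ⟨greenG_moment_aux β hβ0 hβ2 a ha t ht, ?_⟩
  have h := greenG_moment_aux β hβ0 hβ2 0 (by norm_num) t ht
  have hceil : ⌈β⌉₊ = 1 ∨ ⌈β⌉₊ = 2 := by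
    have h1 : 0 < ⌈β⌉₊ := Nat.ceil_pos.mpr hβ0
    have h2 : ⌈β⌉₊ ≤ 2 := Nat.ceil_le.mpr (by push_cast; linarith)
    omega
  have hG : Real.Gamma (⌈β⌉₊ : ℝ) = 1 := by
    rcases hceil with h | h <;> rw [h]
    · simp
    · simp
  simpa [hG] using h
end

section
/- For β ∈ (0,2), t > 0 and ξ ∈ ℝ, the Fourier transform of the Green function is ∫_ℝ e^{−i ξ x} · G_β(t,x) dx = t^{⌈β⌉−1} · E_{β,⌈β⌉}(−t^β ξ²), where E_{α,β} is the two-parameter Mittag-Leffler function. -/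
open MeasureTheory

/-- The two-parameter Mittag-Leffler function `E_{α,β}(z) = ∑ z^k / Γ(α k + β)`. -/
noncomputable def mittagLeffler (α b : ℝ) (z : ℝ) : ℝ :=
  ∑' k : ℕ, z ^ k / Real.Gamma (α * (k : ℝ) + b)


/-- cosine bound on the half plane -/
lemma gf_cos_bound {p θ : ℝ} (hp0 : 0 ≤ p) (hθ : |θ| ≤ Real.pi / 2) :
    Real.cos (θ * p) ≤ p * (Real.pi / 2) * Real.cos θ + Real.cos (p * (Real.pi / 2)) := by
  have h1 : Real.cos (θ * p) = Real.cos (|θ| * p) := by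
    rcases abs_cases θ with h | h <;> rw [h.1]
    rw [neg_mul, Real.cos_neg]
  have h2 : Real.cos θ = Real.cos |θ| := (Real.cos_abs θ).symm
  rw [h1, h2]
  have h3 := (abs_le.1 (Real.abs_cos_sub_cos_le (|θ| * p) (p * (Real.pi / 2)))).2
  have h4 := Real.one_sub_mul_le_cos (abs_nonneg θ) hθ
  have h5 : |(|θ| * p - p * (Real.pi / 2))| = p * (Real.pi / 2 - |θ|) := by
    rw [abs_of_nonpos] <;> nlinarith
  rw [h5] at h3
  have h6 : Real.pi / 2 - |θ| ≤ Real.pi / 2 * Real.cos |θ| := by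
    have := mul_le_mul_of_nonneg_left h4 (by positivity : 0 ≤ Real.pi / 2)
    have e : Real.pi / 2 * (1 - 2 / Real.pi * |θ|) = Real.pi / 2 - |θ| := by
      field_simp
    linarith
  nlinarith [mul_le_mul_of_nonneg_left h6 hp0]

lemma gf_cos_neg {p : ℝ} (hp1 : 1 < p) (hp2 : p < 2) : Real.cos (p * (Real.pi / 2)) < 0 := by
  have := Real.pi_pos
  apply Real.cos_neg_of_pi_div_two_lt_of_lt <;> nlinarith

lemma gf_re_bound {p : ℝ} (hp0 : 1 < p) {z : ℂ} (hz : 0 ≤ z.re) :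
    (z ^ (p : ℂ)).re ≤ p * (Real.pi / 2) * z.re * ‖z‖ ^ (p - 1)
      + Real.cos (p * (Real.pi / 2)) * ‖z‖ ^ p := by
  rcases eq_or_ne z 0 with rfl | h0
  · have : (p : ℂ) ≠ 0 := by exact_mod_cast (by linarith : p ≠ 0)
    simp [this, Real.zero_rpow (by linarith : p ≠ 0)]
  have hn : 0 < ‖z‖ := norm_pos_iff.2 h0
  rw [Complex.cpow_ofReal_re]
  have h := gf_cos_bound (p := p) (by linarith) (Complex.abs_arg_le_pi_div_two_iff.2 hz)
  have h2 := mul_le_mul_of_nonneg_left h (Real.rpow_nonneg hn.le p)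
  rw [Complex.cos_arg h0] at h2
  have e : ‖z‖ ^ p = ‖z‖ ^ (p - 1) * ‖z‖ := by
    rw [← Real.rpow_add_one hn.ne']; ring_nf
  have e2 : ‖z‖ ^ p * (p * (Real.pi / 2) * (z.re / ‖z‖)) = p * (Real.pi / 2) * z.re * ‖z‖ ^ (p - 1) := by
    rw [e]; field_simp
  linarith

lemma gf_exp_bound {p : ℝ} (hp1 : 1 < p) (hp2 : p < 2) {c : ℝ} (hc : 0 < c) :
    ∃ B > 0, ∃ δ > 0, ∀ z : ℂ, 0 ≤ z.re → z.re ≤ c →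
      ‖Complex.exp (z ^ (p : ℂ))‖ ≤ B * Real.exp (-δ * ‖z‖) := by
  have hδ := gf_cos_neg hp1 hp2
  set d := -Real.cos (p * (Real.pi / 2)) with hd
  have hd0 : 0 < d := by linarith
  set A := p * (Real.pi / 2) * c with hA
  have hA0 : 0 < A := by have := Real.pi_pos; positivity
  set R := 2 * A / d with hR
  have hR0 : 0 < R := by positivity
  refine ⟨Real.exp (A * R ^ (p - 1) + d / 2), Real.exp_pos _, d / 2, by positivity, ?_⟩
  intro z hz hzc
  rw [Complex.norm_exp, ← Real.exp_add]
  apply Real.exp_le_exp.2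
  have h1 := gf_re_bound hp1 hz
  have hn : 0 ≤ ‖z‖ := norm_nonneg z
  have hpi := Real.pi_pos
  have h2 : p * (Real.pi / 2) * z.re * ‖z‖ ^ (p - 1) ≤ A * ‖z‖ ^ (p - 1) := by
    rw [hA]; gcongr
  have h3 : A * ‖z‖ ^ (p - 1) ≤ A * R ^ (p - 1) + d / 2 * ‖z‖ ^ p := by
    rcases le_total ‖z‖ R with h | h
    · have : A * ‖z‖ ^ (p - 1) ≤ A * R ^ (p - 1) := by
        gcongr
      have : 0 ≤ d / 2 * ‖z‖ ^ p := by positivity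
      linarith
    · have hz0 : 0 < ‖z‖ := by linarith
      have e : ‖z‖ ^ p = ‖z‖ ^ (p - 1) * ‖z‖ := by
        rw [← Real.rpow_add_one hz0.ne']; ring_nf
      have : A ≤ d / 2 * ‖z‖ := by
        have : d / 2 * R = A := by rw [hR]; field_simp
        nlinarith
      have h5 := mul_le_mul_of_nonneg_right this (Real.rpow_nonneg hn (p - 1))
      have : 0 ≤ A * R ^ (p - 1) := by positivity
      rw [e]
      linarith
  have h4 : ‖z‖ ≤ 1 + ‖z‖ ^ p := by
    rcases le_total ‖z‖ 1 with h | h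
    · have : 0 ≤ ‖z‖ ^ p := by positivity
      linarith
    · have := Real.self_le_rpow_of_one_le h hp1.le
      linarith
  nlinarith

lemma gf_rpow_exp (a : ℝ) {c δ : ℝ} (hc : 0 < c) (hδ : 0 < δ) :
    ∃ C > 0, ∀ r, c ≤ r → r ^ a * Real.exp (-δ * r) ≤ C * Real.exp (-(δ / 2) * r) := by
  have h := tendsto_rpow_mul_exp_neg_mul_atTop_nhds_zero a (δ / 2) (by positivity)
  have h1 := h.eventually (ge_mem_nhds (zero_lt_one))
  obtain ⟨N, hN⟩ := Filter.eventually_atTop.1 h1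
  have hcont : ContinuousOn (fun r : ℝ => r ^ a * Real.exp (-(δ / 2) * r)) (Set.Icc c N) := by
    apply ContinuousOn.mul
    · intro r hr
      exact (Real.continuousAt_rpow_const _ _ (Or.inl (by linarith [hr.1]))).continuousWithinAt
    · fun_prop
  obtain ⟨C, hC⟩ := isCompact_Icc.exists_bound_of_continuousOn hcont
  refine ⟨max C 1, by positivity, fun r hr => ?_⟩
  have e : Real.exp (-δ * r) = Real.exp (-(δ / 2) * r) * Real.exp (-(δ / 2) * r) := by
    rw [← Real.exp_add]; ring_nf
  rw [e, ← mul_assoc]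
  gcongr
  rcases le_total r N with h | h
  · exact (le_abs_self _).trans ((hC r ⟨hr, h⟩).trans (le_max_left _ _))
  · exact (hN r h).trans (le_max_right _ _)

lemma gf_integrable_exp_abs {δ : ℝ} (hδ : 0 < δ) :
    Integrable (fun v : ℝ => Real.exp (-δ * |v|)) := by
  have h1 : IntegrableOn (fun v : ℝ => Real.exp (-δ * |v|)) (Set.Ioi 0) := by
    refine (exp_neg_integrableOn_Ioi 0 hδ).congr_fun (fun v hv => ?_) measurableSet_Ioi
    simp only [abs_of_pos (Set.mem_Ioi.1 hv)]
  have h2 : IntegrableOn (fun v : ℝ => Real.exp (-δ * |v|)) (Set.Iic 0) := by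
    rw [integrableOn_Iic_iff_integrableOn_Iio]
    have := IntegrableOn.comp_neg_Iio (c := 0) (f := fun v : ℝ => Real.exp (-δ * |v|)) (by simpa using h1)
    simpa using this
  have := h2.union h1
  rwa [Set.Iic_union_Ioi, integrableOn_univ] at this

/-- The basic integrand. -/
noncomputable def gfF (p a : ℝ) (z : ℂ) : ℂ := Complex.exp (z ^ (p : ℂ)) * z ^ (a : ℂ)

/-- vertical line -/
noncomputable def gfw (c v : ℝ) : ℂ := (c : ℂ) + (v : ℂ) * Complex.I

lemma gfw_re (c v : ℝ) : (gfw c v).re = c := by simp [gfw]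
lemma gfw_im (c v : ℝ) : (gfw c v).im = v := by simp [gfw]

lemma gfw_slit {c : ℝ} (hc : 0 < c) (v : ℝ) : gfw c v ∈ Complex.slitPlane :=
  Or.inl (by rwa [gfw_re])

lemma gfw_ne {c : ℝ} (hc : 0 < c) (v : ℝ) : gfw c v ≠ 0 :=
  Complex.slitPlane_ne_zero (gfw_slit hc v)

lemma gfw_norm_re (c v : ℝ) : |c| ≤ ‖gfw c v‖ := by
  simpa [gfw_re] using Complex.abs_re_le_norm (gfw c v)

lemma gfw_norm_im (c v : ℝ) : |v| ≤ ‖gfw c v‖ := by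
  simpa [gfw_im] using Complex.abs_im_le_norm (gfw c v)

lemma gfw_cont : Continuous (fun q : ℝ × ℝ => gfw q.1 q.2) := by
  unfold gfw; fun_prop

lemma gfw_cont_right (c : ℝ) : Continuous (gfw c) := by
  unfold gfw; fun_prop

lemma gfF_norm_bound {p : ℝ} (hp1 : 1 < p) (hp2 : p < 2) (a : ℝ) {c C : ℝ} (hc : 0 < c)
    (hcC : c ≤ C) :
    ∃ B > 0, ∃ δ > 0, ∀ x v : ℝ, c ≤ x → x ≤ C →
      ‖gfF p a (gfw x v)‖ ≤ B * Real.exp (-δ * |v|) := by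
  obtain ⟨B, hB, δ, hδ, h⟩ := gf_exp_bound hp1 hp2 (lt_of_lt_of_le hc hcC)
  obtain ⟨D, hD, h'⟩ := gf_rpow_exp a hc hδ
  refine ⟨B * D, by positivity, δ / 2, by positivity, fun x v hx hxC => ?_⟩
  have h1 := h (gfw x v) (by rw [gfw_re]; linarith) (by rw [gfw_re]; linarith)
  have h2 := h' ‖gfw x v‖ (by linarith [gfw_norm_re x v, le_abs_self x])
  have h3 : Real.exp (-(δ / 2) * ‖gfw x v‖) ≤ Real.exp (-(δ / 2) * |v|) := by
    apply Real.exp_le_exp.2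
    have := gfw_norm_im x v
    nlinarith
  rw [gfF, norm_mul, Complex.norm_cpow_real]
  calc _ ≤ B * Real.exp (-δ * ‖gfw x v‖) * ‖gfw x v‖ ^ a := by gcongr
    _ = B * (‖gfw x v‖ ^ a * Real.exp (-δ * ‖gfw x v‖)) := by ring
    _ ≤ B * (D * Real.exp (-(δ / 2) * |v|)) := mul_le_mul_of_nonneg_left (h2.trans (by gcongr)) hB.le
    _ = _ := by ring

lemma gfF_hasDerivAt (p a : ℝ) {z : ℂ} (hz : z ∈ Complex.slitPlane) :
    HasDerivAt (gfF p a) (p * gfF p (a + p - 1) z + a * gfF p (a - 1) z) z := by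
  have h0 := Complex.slitPlane_ne_zero hz
  have h1 : HasDerivAt (fun z : ℂ => z ^ (p : ℂ)) (p * z ^ ((p : ℂ) - 1)) z := by
    simpa using (hasDerivAt_id z).cpow_const (c := (p : ℂ)) hz
  have h2 : HasDerivAt (fun z : ℂ => z ^ (a : ℂ)) (a * z ^ ((a : ℂ) - 1)) z := by
    simpa using (hasDerivAt_id z).cpow_const (c := (a : ℂ)) hz
  refine (h1.cexp.mul h2).congr_deriv ?_
  simp only [gfF]
  have e : z ^ (((a + p - 1 : ℝ)) : ℂ) = z ^ ((p : ℂ) - 1) * z ^ (a : ℂ) := by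
    rw [← Complex.cpow_add _ _ h0]; push_cast; ring_nf
  rw [e]; push_cast; ring

lemma gfF_continuous (p a : ℝ) {c : ℝ} (hc : 0 < c) : Continuous (fun v => gfF p a (gfw c v)) := by
  rw [continuous_iff_continuousAt]
  intro v
  exact ContinuousAt.comp (f := gfw c) (g := gfF p a)
    (gfF_hasDerivAt p a (gfw_slit hc v)).continuousAt (gfw_cont_right c).continuousAt

lemma gfF_integrable {p : ℝ} (hp1 : 1 < p) (hp2 : p < 2) (a : ℝ) {c : ℝ} (hc : 0 < c) :
    Integrable (fun v => gfF p a (gfw c v)) := by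
  obtain ⟨B, hB, δ, hδ, h⟩ := gfF_norm_bound hp1 hp2 a hc le_rfl
  exact ((gf_integrable_exp_abs hδ).const_mul B).mono' (gfF_continuous p a hc).aestronglyMeasurable
    (Filter.Eventually.of_forall fun v => h c v le_rfl le_rfl)

/-- the contour integral -/
noncomputable def gfH (p a c : ℝ) : ℂ := ∫ v : ℝ, gfF p a (gfw c v)

lemma gfH_rec {p : ℝ} (hp1 : 1 < p) (hp2 : p < 2) (a : ℝ) {c : ℝ} (hc : 0 < c) :
    p * gfH p (a + p - 1) c + a * gfH p (a - 1) c = 0 := by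
  have hI1 := (gfF_integrable hp1 hp2 (a + p - 1) hc).const_mul (p : ℂ)
  have hI2 := (gfF_integrable hp1 hp2 (a - 1) hc).const_mul (a : ℂ)
  have hd : ∀ v, HasDerivAt (fun v => gfF p a (gfw c v))
      ((p * gfF p (a + p - 1) (gfw c v) + a * gfF p (a - 1) (gfw c v)) * Complex.I) v := by
    intro v
    have hw : HasDerivAt (gfw c) Complex.I v := by
      unfold gfw
      simpa using ((Complex.ofRealCLM.hasDerivAt (x := v)).mul_const Complex.I).const_add (c : ℂ)
    exact (gfF_hasDerivAt p a (gfw_slit hc v)).comp v hw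
  have := integral_eq_zero_of_hasDerivAt_of_integrable hd ((hI1.add hI2).mul_const Complex.I)
    (gfF_integrable hp1 hp2 a hc)
  rw [integral_mul_const] at this
  have h0 := (mul_eq_zero.1 this).resolve_right Complex.I_ne_zero
  rw [integral_add hI1 hI2, integral_const_mul, integral_const_mul] at h0
  exact h0

lemma gfH_hasDerivAt {p : ℝ} (hp1 : 1 < p) (hp2 : p < 2) (a : ℝ) {c : ℝ} (hc : 0 < c) :
    HasDerivAt (gfH p a) 0 c := by
  obtain ⟨B, hB, δ, hδ, h⟩ := gfF_norm_bound hp1 hp2 (a + p - 1) (c := c / 2) (C := 2 * c)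
    (by linarith) (by linarith)
  obtain ⟨B', hB', δ', hδ', h'⟩ := gfF_norm_bound hp1 hp2 (a - 1) (c := c / 2) (C := 2 * c)
    (by linarith) (by linarith)
  have hI1 := (gfF_integrable hp1 hp2 (a + p - 1) hc).const_mul (p : ℂ)
  have hI2 := (gfF_integrable hp1 hp2 (a - 1) hc).const_mul (a : ℂ)
  have key := (hasDerivAt_integral_of_dominated_loc_of_deriv_le (μ := volume)
    (F := fun x v => gfF p a (gfw x v))
    (F' := fun x v => p * gfF p (a + p - 1) (gfw x v) + a * gfF p (a - 1) (gfw x v))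
    (bound := fun v => p * (B * Real.exp (-δ * |v|)) + |a| * (B' * Real.exp (-δ' * |v|)))
    (s := Set.Ioo (c / 2) (2 * c)) (x₀ := c) (Ioo_mem_nhds (by linarith) (by linarith)) ?_
    (gfF_integrable hp1 hp2 a hc) (hI1.add hI2).aestronglyMeasurable ?_ ?_ ?_).2
  · rw [integral_add hI1 hI2, integral_const_mul, integral_const_mul] at key
    have := gfH_rec hp1 hp2 a hc
    unfold gfH at this
    rwa [this] at key
  · filter_upwards [lt_mem_nhds hc] with x hx
    exact (gfF_continuous p a hx).aestronglyMeasurable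
  · refine Filter.Eventually.of_forall fun v x hx => ?_
    refine (norm_add_le _ _).trans ?_
    rw [norm_mul, norm_mul, Complex.norm_real, Complex.norm_real, Real.norm_eq_abs, Real.norm_eq_abs,
      abs_of_pos (by linarith : 0 < p)]
    gcongr
    · exact h x v hx.1.le hx.2.le
    · exact h' x v hx.1.le hx.2.le
  · exact (((gf_integrable_exp_abs hδ).const_mul B).const_mul p).add
      (((gf_integrable_exp_abs hδ').const_mul B').const_mul |a|)
  · refine Filter.Eventually.of_forall fun v x hx => ?_
    have hw : HasDerivAt (fun x => gfw x v) 1 x := by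
      unfold gfw
      simpa using (Complex.ofRealCLM.hasDerivAt (x := x)).add_const ((v : ℂ) * Complex.I)
    have hx0 : 0 < x := by linarith [hx.1]
    have := (gfF_hasDerivAt p a (gfw_slit hx0 v)).comp x hw
    rw [mul_one] at this
    exact this

lemma gfH_const {p : ℝ} (hp1 : 1 < p) (hp2 : p < 2) (a : ℝ) {c c' : ℝ} (hc : 0 < c) (hc' : 0 < c') :
    gfH p a c = gfH p a c' := by
  refine isOpen_Ioi.is_const_of_deriv_eq_zero (s := Set.Ioi (0 : ℝ)) (convex_Ioi 0).isPreconnected ?_ ?_ hc hc'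
  · exact fun x hx => (gfH_hasDerivAt hp1 hp2 a hx).differentiableAt.differentiableWithinAt
  · exact fun x hx => (gfH_hasDerivAt hp1 hp2 a hx).deriv

lemma gf_integrable_abs {f : ℝ → ℝ} (hf : IntegrableOn f (Set.Ioi 0)) :
    Integrable (fun v : ℝ => f |v|) := by
  have h1 : IntegrableOn (fun v : ℝ => f |v|) (Set.Ioi 0) := by
    refine hf.congr_fun (fun v hv => ?_) measurableSet_Ioi
    simp only [abs_of_pos (Set.mem_Ioi.1 hv)]
  have h2 : IntegrableOn (fun v : ℝ => f |v|) (Set.Iic 0) := by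
    rw [integrableOn_Iic_iff_integrableOn_Iio]
    have := IntegrableOn.comp_neg_Iio (c := 0) (f := fun v : ℝ => f |v|) (by simpa using h1)
    simpa using this
  have := h2.union h1
  rwa [Set.Iic_union_Ioi, integrableOn_univ] at this

lemma gf_integrableOn_rpow_exp {a δ : ℝ} (ha : -1 < a) (hδ : 0 < δ) :
    IntegrableOn (fun v : ℝ => v ^ a * Real.exp (-δ * v)) (Set.Ioi 0) := by
  simpa using integrableOn_rpow_mul_exp_neg_mul_rpow ha one_pos hδ

lemma gf_gamma_integral {b : ℝ} (hb : 0 < b) {r : ℂ} (hr : 0 < r.re) :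
    ∫ t in Set.Ioi (0 : ℝ), (t : ℂ) ^ ((b : ℂ) - 1) * Complex.exp (-(r * t))
      = (1 / r) ^ (b : ℂ) * Complex.Gamma b := by
  set U : Set ℂ := {z | 0 < z.re} with hU
  have hUo : IsOpen U := isOpen_lt continuous_const Complex.continuous_re
  have hUc : IsPreconnected U := (convex_halfSpace_re_gt 0).isPreconnected
  have hmeas : ∀ (z : ℂ) (k : ℝ), AEStronglyMeasurable
      (fun t : ℝ => (t : ℂ) ^ (k : ℂ) * Complex.exp (-(z * t)))
      (volume.restrict (Set.Ioi 0)) := by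
    intro z k
    refine ContinuousOn.aestronglyMeasurable ?_ measurableSet_Ioi
    apply ContinuousOn.mul
    · intro t ht
      exact ((Complex.continuousAt_ofReal_cpow_const t k (Or.inr (ne_of_gt ht)))).continuousWithinAt
    · fun_prop
  have hnorm : ∀ (z : ℂ) (k t : ℝ), 0 < t → ‖(t : ℂ) ^ (k : ℂ) * Complex.exp (-(z * t))‖
      = t ^ k * Real.exp (-z.re * t) := by
    intro z k t ht
    rw [norm_mul, Complex.norm_cpow_real, Complex.norm_exp]
    simp [abs_of_pos ht]
  have hcast : (b : ℂ) - 1 = ((b - 1 : ℝ) : ℂ) := by push_cast; rfl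
  have hf : DifferentiableOn ℂ (fun z : ℂ => ∫ t in Set.Ioi (0 : ℝ),
      (t : ℂ) ^ ((b : ℂ) - 1) * Complex.exp (-(z * t))) U := by
    intro z hz
    have hz' : 0 < z.re := hz
    set V : Set ℂ := {y | z.re / 2 < y.re} with hV
    have hVn : V ∈ nhds z := (isOpen_lt continuous_const Complex.continuous_re).mem_nhds
      (by simp only [Set.mem_ofPred_eq]; linarith)
    have key := (hasDerivAt_integral_of_dominated_loc_of_deriv_le
      (μ := volume.restrict (Set.Ioi (0 : ℝ)))
      (F := fun (z : ℂ) (t : ℝ) => (t : ℂ) ^ ((b : ℂ) - 1) * Complex.exp (-(z * t)))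
      (F' := fun (z : ℂ) (t : ℝ) => -((t : ℂ) * ((t : ℂ) ^ ((b : ℂ) - 1) * Complex.exp (-(z * t)))))
      (bound := fun t => t ^ b * Real.exp (-(z.re / 2) * t)) (x₀ := z) hVn ?_ ?_ ?_ ?_ ?_ ?_).2
    · exact key.differentiableAt.differentiableWithinAt
    · rw [hcast]; exact Filter.Eventually.of_forall fun y => hmeas y _
    · rw [hcast]
      refine (gf_integrableOn_rpow_exp (a := b - 1) (by linarith) hz').mono' (hmeas z _) ?_
      filter_upwards [ae_restrict_mem measurableSet_Ioi] with t ht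
      rw [hnorm _ _ _ ht]
    · rw [hcast]
      exact (Complex.measurable_ofReal.aestronglyMeasurable.mul (hmeas z _)).neg
    · rw [hcast]
      filter_upwards [ae_restrict_mem measurableSet_Ioi] with t ht y hy
      have ht' : 0 < t := ht
      rw [norm_neg, norm_mul, hnorm _ _ _ ht, Complex.norm_real, Real.norm_eq_abs, abs_of_pos ht',
        ← mul_assoc]
      have e : t * t ^ (b - 1) = t ^ b := by
        rw [mul_comm, ← Real.rpow_add_one ht'.ne']; ring_nf
      rw [e]
      have hy' : z.re / 2 < y.re := hy
      gcongr
    · exact gf_integrableOn_rpow_exp (by linarith) (by linarith)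
    · refine Filter.Eventually.of_forall fun t y _ => ?_
      have h1 : HasDerivAt (fun y : ℂ => -(y * (t : ℂ))) (-(t : ℂ)) y := by
        have := ((hasDerivAt_id y).mul_const (t : ℂ)).neg
        rw [one_mul] at this
        exact this
      refine (h1.cexp.const_mul ((t : ℂ) ^ ((b : ℂ) - 1))).congr_deriv ?_
      ring
  have hg : DifferentiableOn ℂ (fun z : ℂ => (1 / z) ^ (b : ℂ) * Complex.Gamma b) U := by
    intro z hz
    have hz' : 0 < z.re := hz
    have hz0 : z ≠ 0 := by rintro rfl; simp at hz'
    have hs : 1 / z ∈ Complex.slitPlane := by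
      left
      rw [one_div, Complex.inv_re]
      exact div_pos hz' (Complex.normSq_pos.2 hz0)
    have : DifferentiableAt ℂ (fun z : ℂ => 1 / z) z := by
      simpa using differentiableAt_inv hz0
    exact ((this.cpow_const hs).mul_const _).differentiableWithinAt
  have h1 : (1 : ℂ) ∈ U := by simp [hU]
  refine AnalyticOnNhd.eqOn_of_preconnected_of_frequently_eq (hf.analyticOnNhd hUo)
    (hg.analyticOnNhd hUo) hUc h1 ?_ hr
  have ht : Filter.Tendsto (fun x : ℝ => (x : ℂ)) (nhdsWithin 1 {1}ᶜ) (nhdsWithin 1 {1}ᶜ) := by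
    apply tendsto_nhdsWithin_of_tendsto_nhds_of_eventually_within
    · have := (Complex.continuous_ofReal.tendsto (1 : ℝ)).mono_left
        (nhdsWithin_le_nhds (s := {1}ᶜ))
      simpa using this
    · filter_upwards [self_mem_nhdsWithin] with x hx
      simpa using hx
  refine ht.frequently (Filter.Eventually.frequently ?_)
  filter_upwards [mem_nhdsWithin_of_mem_nhds (lt_mem_nhds (zero_lt_one))] with x hx
  exact Complex.integral_cpow_mul_exp_neg_mul_Ioi (by simpa using hb) hx

lemma gfF_bound0 {p : ℝ} (hp1 : 1 < p) (hp2 : p < 2) {a : ℝ} (ha : -1 < a) :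
    ∃ g : ℝ → ℝ, Integrable g ∧ ∀ c v : ℝ, 0 ≤ c → c ≤ 1 → v ≠ 0 → ‖gfF p a (gfw c v)‖ ≤ g v := by
  obtain ⟨B, hB, δ, hδ, h⟩ := gf_exp_bound hp1 hp2 one_pos
  have hm : ∀ η > 0, ∀ c v : ℝ, Real.exp (-η * ‖gfw c v‖) ≤ Real.exp (-η * |v|) := by
    intro η hη c v
    apply Real.exp_le_exp.2
    have := gfw_norm_im c v
    nlinarith
  rcases lt_or_ge a 0 with h0 | h0
  · refine ⟨fun v => B * (|v| ^ a * Real.exp (-δ * |v|)),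
      (gf_integrable_abs (gf_integrableOn_rpow_exp ha hδ)).const_mul B, ?_⟩
    intro c v hc hc1 hv
    have h1 := h (gfw c v) (by rwa [gfw_re]) (by rwa [gfw_re])
    have hv' : 0 < |v| := abs_pos.2 hv
    rw [gfF, norm_mul, Complex.norm_cpow_real]
    have h2 : ‖gfw c v‖ ^ a ≤ |v| ^ a :=
      Real.rpow_le_rpow_of_nonpos hv' (gfw_norm_im c v) h0.le
    calc _ ≤ B * Real.exp (-δ * |v|) * |v| ^ a :=
          mul_le_mul (h1.trans (mul_le_mul_of_nonneg_left (hm δ hδ c v) hB.le)) h2 (by positivity)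
            (by positivity)
      _ = _ := by ring
  · obtain ⟨D, hD, h'⟩ := gf_rpow_exp a one_pos hδ
    refine ⟨fun v => B * ((D + 1) * Real.exp (-(δ / 2) * |v|)),
      ((gf_integrable_exp_abs (half_pos hδ)).const_mul (D + 1)).const_mul B, ?_⟩
    intro c v hc hc1 hv
    have h1 := h (gfw c v) (by rwa [gfw_re]) (by rwa [gfw_re])
    rw [gfF, norm_mul, Complex.norm_cpow_real]
    have h2 : ‖gfw c v‖ ^ a * Real.exp (-δ * ‖gfw c v‖)
        ≤ (D + 1) * Real.exp (-(δ / 2) * ‖gfw c v‖) := by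
      rcases le_total 1 ‖gfw c v‖ with hr | hr
      · refine (h' _ hr).trans ?_
        gcongr
        linarith
      · have e1 : ‖gfw c v‖ ^ a ≤ D + 1 := (Real.rpow_le_one (norm_nonneg _) hr h0).trans (by linarith)
        have e2 : Real.exp (-δ * ‖gfw c v‖) ≤ Real.exp (-(δ / 2) * ‖gfw c v‖) := by
          apply Real.exp_le_exp.2
          have := norm_nonneg (gfw c v)
          nlinarith
        exact mul_le_mul e1 e2 (by positivity) (by positivity)
    calc _ ≤ B * Real.exp (-δ * ‖gfw c v‖) * ‖gfw c v‖ ^ a := by gcongr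
      _ = B * (‖gfw c v‖ ^ a * Real.exp (-δ * ‖gfw c v‖)) := by ring
      _ ≤ _ := mul_le_mul_of_nonneg_left (h2.trans (mul_le_mul_of_nonneg_left
        (hm _ (half_pos hδ) c v) (by positivity))) hB.le

lemma gfw_slit0 {c v : ℝ} (hv : v ≠ 0) : gfw c v ∈ Complex.slitPlane :=
  Or.inr (by rwa [gfw_im])

lemma gfF_meas0 (p a : ℝ) : AEStronglyMeasurable (fun v => gfF p a (gfw 0 v)) volume := by
  have : Measurable (gfw 0) := (gfw_cont_right 0).measurable
  have h : Measurable (fun v => gfF p a (gfw 0 v)) := by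
    unfold gfF
    exact ((this.pow_const _).cexp).mul (this.pow_const _)
  exact h.aestronglyMeasurable

lemma gf_ae_ne : ∀ᵐ v : ℝ, v ≠ 0 := by
  simp [ae_iff]

lemma gfF_integrable0 {p : ℝ} (hp1 : 1 < p) (hp2 : p < 2) {a : ℝ} (ha : -1 < a) :
    Integrable (fun v => gfF p a (gfw 0 v)) := by
  obtain ⟨g, hg, h⟩ := gfF_bound0 hp1 hp2 ha
  refine hg.mono' (gfF_meas0 p a) ?_
  filter_upwards [gf_ae_ne] with v hv using h 0 v le_rfl zero_le_one hv

lemma gfH_zero {p : ℝ} (hp1 : 1 < p) (hp2 : p < 2) {a : ℝ} (ha : -1 < a) {c : ℝ} (hc : 0 < c) :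
    gfH p a c = gfH p a 0 := by
  obtain ⟨g, hg, h⟩ := gfF_bound0 hp1 hp2 ha
  have ht : Filter.Tendsto (gfH p a) (nhdsWithin 0 (Set.Ioi 0)) (nhds (gfH p a 0)) := by
    refine tendsto_integral_filter_of_dominated_convergence g ?_ ?_ hg ?_
    · filter_upwards [self_mem_nhdsWithin] with x hx
      exact (gfF_continuous p a hx).aestronglyMeasurable
    · filter_upwards [Ioo_mem_nhdsGT (zero_lt_one (α := ℝ))] with x hx
      filter_upwards [gf_ae_ne] with v hv using h x v hx.1.le hx.2.le hv
    · filter_upwards [gf_ae_ne] with v hv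
      have h1 : ContinuousAt (fun x => gfF p a (gfw x v)) 0 := by
        refine ContinuousAt.comp (f := fun x => gfw x v) (g := gfF p a)
          (gfF_hasDerivAt p a (gfw_slit0 hv)).continuousAt ?_
        unfold gfw; fun_prop
      exact h1.tendsto.mono_left nhdsWithin_le_nhds
  refine tendsto_nhds_unique ?_ ht
  refine tendsto_const_nhds.congr' ?_
  filter_upwards [self_mem_nhdsWithin] with x hx using gfH_const hp1 hp2 a hc hx

lemma gf_cpow_ray {v : ℝ} (hv : 0 < v) {ω : ℝ} (h1 : -Real.pi < ω) (h2 : ω ≤ Real.pi) (k : ℝ) :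
    ((v : ℂ) * Complex.exp (ω * Complex.I)) ^ (k : ℂ)
      = ((v ^ k : ℝ) : ℂ) * Complex.exp (k * ω * Complex.I) := by
  have h0 : (v : ℂ) * Complex.exp (ω * Complex.I) ≠ 0 :=
    mul_ne_zero (by exact_mod_cast hv.ne') (Complex.exp_ne_zero _)
  rw [Complex.cpow_def_of_ne_zero h0, Complex.log_ofReal_mul hv (Complex.exp_ne_zero _),
    Complex.log_exp (by simpa using h1) (by simpa using h2), Real.rpow_def_of_pos hv, add_mul,
    Complex.exp_add]
  push_cast
  congr 2
  ring

lemma gf_ray_integral {p : ℝ} (hp1 : 1 < p) (hp2 : p < 2) {a : ℝ} (ha : -1 < a) {ε : ℝ}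
    (hε : ε = 1 ∨ ε = -1) :
    ∫ v in Set.Ioi (0 : ℝ), gfF p a ((v : ℂ) * Complex.exp ((ε * (Real.pi / 2) : ℝ) * Complex.I))
      = (1 / p) * Complex.Gamma (((a + 1) / p : ℝ))
        * Complex.exp ((ε * (Real.pi * ((a + 1) / p) - Real.pi / 2) : ℝ) * Complex.I) := by
  have hp0 : 0 < p := by linarith
  set ω := ε * (Real.pi / 2) with hω
  set b := (a + 1) / p with hb
  have hb0 : 0 < b := div_pos (by linarith) hp0
  have hpi := Real.pi_pos
  have hω1 : -Real.pi < ω := by rcases hε with h | h <;> rw [hω, h] <;> linarith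
  have hω2 : ω ≤ Real.pi := by rcases hε with h | h <;> rw [hω, h] <;> linarith
  set r : ℂ := -Complex.exp (p * ω * Complex.I) with hr
  have hrre : 0 < r.re := by
    have e : (p * ω * Complex.I : ℂ) = ((p * ω : ℝ) : ℂ) * Complex.I := by push_cast; ring
    rw [hr, e, Complex.neg_re, Complex.exp_ofReal_mul_I_re]
    have : Real.cos (p * ω) = Real.cos (p * (Real.pi / 2)) := by
      rcases hε with h | h
      · rw [hω, h]; ring_nf
      · rw [hω, h, ← Real.cos_neg]; ring_nf
    rw [this]
    linarith [gf_cos_neg hp1 hp2]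
  have hG := gf_gamma_integral hb0 hrre
  rw [← integral_comp_rpow_Ioi_of_pos hp0] at hG
  have hcongr : ∫ v in Set.Ioi (0 : ℝ), gfF p a ((v : ℂ) * Complex.exp ((ω : ℝ) * Complex.I))
      = ∫ v in Set.Ioi (0 : ℝ), (Complex.exp (a * ω * Complex.I) / p) * ((p * v ^ (p - 1) : ℝ) •
        (((v ^ p : ℝ) : ℂ) ^ ((b : ℂ) - 1) * Complex.exp (-(r * (v ^ p : ℝ))))) := by
    refine setIntegral_congr_fun measurableSet_Ioi (fun v hv => ?_)
    have hv' : 0 < v := hv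
    simp only [gfF]
    rw [gf_cpow_ray hv' hω1 hω2, gf_cpow_ray hv' hω1 hω2]
    have e1 : -(r * ((v ^ p : ℝ) : ℂ)) = ((v ^ p : ℝ) : ℂ) * Complex.exp (p * ω * Complex.I) := by
      rw [hr]; ring
    have e2 : ((v ^ p : ℝ) : ℂ) ^ ((b : ℂ) - 1) = (((v ^ p) ^ (b - 1) : ℝ) : ℂ) := by
      rw [Complex.ofReal_cpow (Real.rpow_nonneg hv'.le p) (b - 1), Complex.ofReal_sub, Complex.ofReal_one]
    have e3 : v ^ a = v ^ (p - 1) * (v ^ p) ^ (b - 1) := by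
      rw [← Real.rpow_mul hv'.le, ← Real.rpow_add hv']
      congr 1
      rw [hb]; field_simp; ring
    rw [e1, e2, e3, Complex.real_smul]
    have : (p : ℂ) ≠ 0 := by exact_mod_cast hp0.ne'
    push_cast
    field_simp
  rw [hcongr, integral_const_mul, hG]
  have hinv : 1 / r = Complex.exp ((ε * Real.pi - p * ω : ℝ) * Complex.I) := by
    have e : Complex.exp ((ε * Real.pi : ℝ) * Complex.I) = -1 := by
      rcases hε with h | h
      · rw [h]; simp
      · rw [h]; simp [Complex.exp_neg]
    rw [Complex.ofReal_sub, sub_mul, Complex.exp_sub, e, hr]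
    push_cast
    rw [div_neg, neg_div]
  have hpow : (1 / r) ^ (b : ℂ) = Complex.exp ((b * (ε * Real.pi - p * ω) : ℝ) * Complex.I) := by
    rw [hinv, Complex.cpow_def_of_ne_zero (Complex.exp_ne_zero _), Complex.log_exp]
    · push_cast; congr 1; ring
    · rw [Complex.im_ofReal_mul, Complex.I_im, mul_one]
      rcases hε with h | h <;> rw [hω, h] <;> nlinarith
    · rw [Complex.im_ofReal_mul, Complex.I_im, mul_one]
      rcases hε with h | h <;> rw [hω, h] <;> nlinarith
  rw [hpow]
  have hfin : Complex.exp (a * ω * Complex.I) * Complex.exp ((b * (ε * Real.pi - p * ω) : ℝ) * Complex.I)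
      = Complex.exp ((ε * (Real.pi * b - Real.pi / 2) : ℝ) * Complex.I) := by
    rw [← Complex.exp_add]
    congr 1
    have : a * ω + b * (ε * Real.pi - p * ω) = ε * (Real.pi * b - Real.pi / 2) := by
      have : b * p = a + 1 := by rw [hb]; field_simp
      have e : b * (ε * Real.pi - p * ω) = b * ε * Real.pi - (b * p) * ω := by ring
      rw [e, this, hω]; ring
    rw [← this]; push_cast; ring
  rw [← hfin]
  ring

lemma gfH_eval {p : ℝ} (hp1 : 1 < p) (hp2 : p < 2) {a : ℝ} (ha : -1 < a) {c : ℝ} (hc : 0 < c) :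
    p * gfH p a c = ((2 * Real.Gamma ((a + 1) / p) * Real.sin (Real.pi * ((a + 1) / p)) : ℝ) : ℂ) := by
  rw [gfH_zero hp1 hp2 ha hc]
  have hI := gfF_integrable0 hp1 hp2 ha
  have hsplit : gfH p a 0 = (∫ v in Set.Ioi (0 : ℝ), gfF p a (gfw 0 (-v)))
      + ∫ v in Set.Ioi (0 : ℝ), gfF p a (gfw 0 v) := by
    unfold gfH
    rw [integral_comp_neg_Ioi (0 : ℝ) (fun v => gfF p a (gfw 0 v)), neg_zero,
      intervalIntegral.integral_Iic_add_Ioi hI.integrableOn hI.integrableOn]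
  have h1 := gf_ray_integral hp1 hp2 ha (ε := 1) (Or.inl rfl)
  have h2 := gf_ray_integral hp1 hp2 ha (ε := -1) (Or.inr rfl)
  have e1 : ∀ v : ℝ, (v : ℂ) * Complex.exp (((1 : ℝ) * (Real.pi / 2) : ℝ) * Complex.I) = gfw 0 v := by
    intro v
    rw [one_mul]; push_cast; rw [Complex.exp_pi_div_two_mul_I]; simp [gfw]
  have e2 : ∀ v : ℝ, (v : ℂ) * Complex.exp (((-1 : ℝ) * (Real.pi / 2) : ℝ) * Complex.I)
      = gfw 0 (-v) := by
    intro v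
    have : (((-1 : ℝ) * (Real.pi / 2) : ℝ) : ℂ) * Complex.I = -((Real.pi : ℂ) / 2 * Complex.I) := by
      push_cast; ring
    rw [this, Complex.exp_neg, Complex.exp_pi_div_two_mul_I]; simp [gfw]
  simp only [e1] at h1
  simp only [e2] at h2
  rw [hsplit, h1, h2]
  set x := Real.pi * ((a + 1) / p) with hx
  have hp0 : (p : ℂ) ≠ 0 := by exact_mod_cast (by linarith : p ≠ 0)
  have hs : Complex.exp ((-1 * (x - Real.pi / 2) : ℝ) * Complex.I)
      + Complex.exp ((1 * (x - Real.pi / 2) : ℝ) * Complex.I) = ((2 * Real.sin x : ℝ) : ℂ) := by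
    rw [← Real.cos_sub_pi_div_two]
    push_cast
    rw [Complex.two_cos]
    simp only [one_mul, neg_mul, add_comm]
  rw [← mul_add, hs, Complex.Gamma_ofReal]
  push_cast
  field_simp

lemma gf_gamma_refl {s : ℝ} (hs : s < 1) :
    Real.Gamma (1 - s) * Real.sin (Real.pi * s) = Real.pi * (Real.Gamma s)⁻¹ := by
  have h := Real.Gamma_mul_Gamma_one_sub s
  have hg : Real.Gamma (1 - s) ≠ 0 := (Real.Gamma_pos_of_pos (by linarith)).ne'
  by_cases h0 : Real.sin (Real.pi * s) = 0
  · rw [h0, div_zero] at h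
    have : Real.Gamma s = 0 := (mul_eq_zero.1 h).resolve_right hg
    rw [h0, this]; simp
  · have hs0 : Real.Gamma s ≠ 0 := by
      intro h1
      rw [h1, zero_mul] at h
      exact (div_ne_zero Real.pi_pos.ne' h0) h.symm
    rw [eq_div_iff h0] at h
    rw [eq_mul_inv_iff_mul_eq₀ hs0]
    linarith

/-- Hankel's formula, as a predicate. -/
def gfHankel (p c s : ℝ) : Prop :=
  p * gfH p (p - 1 - p * s) c = ((2 * Real.pi * (Real.Gamma s)⁻¹ : ℝ) : ℂ)

lemma gfHankel_lt {p : ℝ} (hp1 : 1 < p) (hp2 : p < 2) {c : ℝ} (hc : 0 < c) {s : ℝ} (hs : s < 1) :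
    gfHankel p c s := by
  unfold gfHankel
  rw [gfH_eval hp1 hp2 (by nlinarith) hc]
  have hp0 : p ≠ 0 := by linarith
  have e : (p - 1 - p * s + 1) / p = 1 - s := by field_simp; ring
  rw [e]
  have : Real.sin (Real.pi * (1 - s)) = Real.sin (Real.pi * s) := by
    rw [mul_sub, mul_one, Real.sin_pi_sub]
  rw [this, mul_assoc, gf_gamma_refl hs, mul_assoc]

lemma gfHankel_one {p : ℝ} (hp1 : 1 < p) (hp2 : p < 2) {c : ℝ} (hc : 0 < c) :
    gfHankel p c 1 := by
  obtain ⟨B, hB, δ, hδ, h⟩ := gfF_norm_bound hp1 hp2 (-1) hc le_rfl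
  obtain ⟨B', hB', δ', hδ', h'⟩ := gfF_norm_bound hp1 hp2 1 hc le_rfl
  have ht : Filter.Tendsto (fun s : ℝ => p * gfH p (p - 1 - p * s) c) (nhdsWithin 1 (Set.Iio 1))
      (nhds (p * gfH p (p - 1 - p * 1) c)) := by
    refine Filter.Tendsto.const_mul _ ?_
    refine tendsto_integral_filter_of_dominated_convergence
      (fun v => B * Real.exp (-δ * |v|) + B' * Real.exp (-δ' * |v|)) ?_ ?_ ?_ ?_
    · exact Filter.Eventually.of_forall fun s => (gfF_continuous _ _ hc).aestronglyMeasurable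
    · filter_upwards [Ioo_mem_nhdsLT (zero_lt_one (α := ℝ))] with s hs
      refine Filter.Eventually.of_forall fun v => ?_
      have h1 := h c v le_rfl le_rfl
      have h2 := h' c v le_rfl le_rfl
      refine le_trans ?_ (add_le_add h1 h2)
      simp only [gfF, norm_mul, Complex.norm_cpow_real]
      rw [← mul_add]
      refine mul_le_mul_of_nonneg_left ?_ (norm_nonneg _)
      have hn : 0 < ‖gfw c v‖ := norm_pos_iff.2 (gfw_ne hc v)
      have n1 : 0 ≤ ‖gfw c v‖ ^ (-1 : ℝ) := by positivity
      have n2 : 0 ≤ ‖gfw c v‖ ^ (1 : ℝ) := by positivity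
      rcases le_total 1 ‖gfw c v‖ with hr | hr
      · have := Real.rpow_le_rpow_of_exponent_le hr (by nlinarith [hs.1] : p - 1 - p * s ≤ 1)
        linarith
      · have := Real.rpow_le_rpow_of_exponent_ge hn hr (by nlinarith [hs.2] : -1 ≤ p - 1 - p * s)
        exact this.trans (le_add_of_nonneg_right n2)
    · exact ((gf_integrable_exp_abs hδ).const_mul B).add ((gf_integrable_exp_abs hδ').const_mul B')
    · refine Filter.Eventually.of_forall fun v => ?_
      have : Continuous (fun s : ℝ => gfF p (p - 1 - p * s) (gfw c v)) := by
        unfold gfF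
        have hz := gfw_ne hc v
        refine continuous_const.mul ?_
        refine Continuous.const_cpow (by fun_prop) (Or.inl hz)
      exact (this.tendsto 1).mono_left nhdsWithin_le_nhds
  have ht2 : Filter.Tendsto (fun s : ℝ => ((2 * Real.pi * (Real.Gamma s)⁻¹ : ℝ) : ℂ))
      (nhdsWithin 1 (Set.Iio 1)) (nhds ((2 * Real.pi * (Real.Gamma 1)⁻¹ : ℝ) : ℂ)) := by
    have hg : ContinuousAt Real.Gamma 1 :=
      (Real.differentiableAt_Gamma (fun m => by have : (0 : ℝ) ≤ m := Nat.cast_nonneg m; linarith)).continuousAt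
    have : ContinuousAt (fun s : ℝ => ((2 * Real.pi * (Real.Gamma s)⁻¹ : ℝ) : ℂ)) 1 := by
      refine Complex.continuous_ofReal.continuousAt.comp ?_
      exact continuousAt_const.mul (hg.inv₀ (by simp))
    exact this.tendsto.mono_left nhdsWithin_le_nhds
  refine tendsto_nhds_unique ht (ht2.congr' ?_)
  filter_upwards [self_mem_nhdsWithin] with s hs
  exact (gfHankel_lt hp1 hp2 hc hs).symm

lemma gfHankel_all {p : ℝ} (hp1 : 1 < p) (hp2 : p < 2) {c : ℝ} (hc : 0 < c) (s : ℝ) :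
    gfHankel p c s := by
  have base : ∀ s ≤ 1, gfHankel p c s := by
    intro s hs
    rcases hs.lt_or_eq with h | h
    · exact gfHankel_lt hp1 hp2 hc h
    · rw [h]; exact gfHankel_one hp1 hp2 hc
  have ind : ∀ n : ℕ, ∀ s : ℝ, s ≤ n + 1 → gfHankel p c s := by
    intro n
    induction n with
    | zero => intro s hs; exact base s (by simpa using hs)
    | succ n ih =>
      intro s hs
      rcases le_or_gt s 1 with h | h
      · exact base s h
      have h1 := ih (s - 1) (by push_cast at hs; linarith)
      have h2 := gfH_rec hp1 hp2 (-(p * (s - 1))) hc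
      unfold gfHankel at h1 ⊢
      have e1 : -(p * (s - 1)) + p - 1 = p - 1 - p * (s - 1) := by ring
      have e2 : -(p * (s - 1)) - 1 = p - 1 - p * s := by ring
      rw [e1, e2, h1] at h2
      have hg : Real.Gamma s = (s - 1) * Real.Gamma (s - 1) := by
        have := Real.Gamma_add_one (s := s - 1) (by linarith)
        rwa [sub_add_cancel] at this
      have hs1 : ((s : ℂ) - 1) ≠ 0 := by
        have : ((s - 1 : ℝ) : ℂ) ≠ 0 := by exact_mod_cast (by linarith : s - 1 ≠ 0)
        simpa using this
      rw [hg, mul_inv]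
      push_cast at h2 ⊢
      field_simp
      linear_combination -h2
  obtain ⟨n, hn⟩ := exists_nat_ge s
  exact ind n s (by linarith)

lemma gf_sublinear {q : ℝ} (hq0 : 0 < q) (hq1 : q < 1) (y : ℝ) {η : ℝ} (hη : 0 < η) :
    ∃ K, ∀ r : ℝ, 0 ≤ r → |y| * r ^ q ≤ η * r + K := by
  have ht := (tendsto_rpow_neg_atTop (by linarith : 0 < 1 - q)).const_mul |y|
  rw [mul_zero] at ht
  obtain ⟨R, hR⟩ := Filter.eventually_atTop.1 (ht.eventually (ge_mem_nhds hη))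
  refine ⟨|y| * (max R 1) ^ q, fun r hr => ?_⟩
  rcases le_total r (max R 1) with h | h
  · have : |y| * r ^ q ≤ |y| * (max R 1) ^ q := by gcongr
    nlinarith
  · have hr0 : 0 < r := lt_of_lt_of_le (by positivity) h
    have h1 := hR r ((le_max_left _ _).trans h)
    have e : r ^ q = r ^ (-(1 - q)) * r := by
      rw [← Real.rpow_add_one hr0.ne']; ring_nf
    have h2 := mul_le_mul_of_nonneg_right h1 hr
    have : 0 ≤ |y| * (max R 1) ^ q := by positivity
    rw [e, ← mul_assoc]
    linarith

/-- `w ^ (pL)` on the line -/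
noncomputable def gfq (k c v : ℝ) : ℂ := gfw c v ^ (k : ℂ)

lemma gfq_cont (k : ℝ) {c : ℝ} (hc : 0 < c) : Continuous (gfq k c) := by
  unfold gfq
  exact (gfw_cont_right c).cpow continuous_const (fun v => gfw_slit hc v)

lemma gfq_ne (k : ℝ) {c : ℝ} (hc : 0 < c) (v : ℝ) : gfq k c v ≠ 0 := by
  unfold gfq
  rw [Complex.cpow_ne_zero_iff]
  exact Or.inl (gfw_ne hc v)

lemma gfF_mul_pow (p a k : ℝ) {c : ℝ} (hc : 0 < c) (v : ℝ) (n : ℕ) :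
    gfF p a (gfw c v) * gfq k c v ^ n = gfF p (a + n * k) (gfw c v) := by
  unfold gfF gfq
  rw [← Complex.cpow_nat_mul, mul_assoc, ← Complex.cpow_add _ _ (gfw_ne hc v)]
  push_cast
  rfl

lemma gfF_mul_inv_pow (p a k : ℝ) {c : ℝ} (hc : 0 < c) (v : ℝ) (n : ℕ) :
    gfF p a (gfw c v) * (gfq k c v)⁻¹ ^ n = gfF p (a - n * k) (gfw c v) := by
  have h := gfF_mul_pow p (a - n * k) k hc v n
  rw [sub_add_cancel] at h
  rw [← h, mul_assoc, ← mul_pow, mul_inv_cancel₀ (gfq_ne k hc v), one_pow, mul_one]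

lemma gfq_norm (k c v : ℝ) : ‖gfq k c v‖ = ‖gfw c v‖ ^ k := Complex.norm_cpow_real _ _

lemma gfq_re {k : ℝ} (hk0 : 0 < k) (hk1 : k < 1) {c : ℝ} (hc : 0 < c) (v : ℝ) :
    c ^ k * Real.cos (k * (Real.pi / 2)) ≤ (gfq k c v).re := by
  unfold gfq
  rw [Complex.cpow_ofReal_re]
  have hpi := Real.pi_pos
  have harg : |Complex.arg (gfw c v)| ≤ Real.pi / 2 :=
    Complex.abs_arg_le_pi_div_two_iff.2 (by rw [gfw_re]; exact hc.le)
  have h1 : Real.cos (k * (Real.pi / 2)) ≤ Real.cos (Complex.arg (gfw c v) * k) := by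
    rw [← Real.cos_abs (Complex.arg (gfw c v) * k), abs_mul, abs_of_pos hk0]
    apply Real.cos_le_cos_of_nonneg_of_le_pi
    · positivity
    · nlinarith
    · nlinarith
  have h0 : 0 ≤ Real.cos (k * (Real.pi / 2)) :=
    Real.cos_nonneg_of_neg_pi_div_two_le_of_le (by nlinarith) (by nlinarith)
  have h2 : c ^ k ≤ ‖gfw c v‖ ^ k :=
    Real.rpow_le_rpow hc.le ((le_abs_self c).trans (gfw_norm_re c v)) hk0.le
  exact mul_le_mul h2 h1 h0 (by positivity)

lemma gf_cos_pos {k : ℝ} (hk0 : 0 < k) (hk1 : k < 1) : 0 < Real.cos (k * (Real.pi / 2)) := by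
  have hpi := Real.pi_pos
  exact Real.cos_pos_of_mem_Ioo ⟨by nlinarith, by nlinarith⟩

lemma gfF_exp_integrable {p : ℝ} (hp1 : 1 < p) (hp2 : p < 2) (a : ℝ) {k : ℝ} (hk0 : 0 < k)
    (hk1 : k < 1) {c : ℝ} (hc : 0 < c) {y : ℝ} (hy : 0 ≤ y) :
    Integrable (fun v => ‖gfF p a (gfw c v)‖ * Real.exp (y * ‖gfq k c v‖)) := by
  obtain ⟨B, hB, δ, hδ, h⟩ := gf_exp_bound hp1 hp2 hc
  obtain ⟨D, hD, h'⟩ := gf_rpow_exp a hc (half_pos hδ)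
  obtain ⟨K, hK⟩ := gf_sublinear hk0 hk1 y (half_pos hδ)
  have hδ4 : 0 < δ / 2 / 2 := by positivity
  refine ((gf_integrable_exp_abs hδ4).const_mul (B * Real.exp K * D)).mono' ?_ ?_
  · refine Continuous.aestronglyMeasurable ?_
    exact (gfF_continuous p a hc).norm.mul
      (Real.continuous_exp.comp (continuous_const.mul (gfq_cont k hc).norm))
  · refine Filter.Eventually.of_forall fun v => ?_
    have h1 := h (gfw c v) (by rw [gfw_re]; exact hc.le) (by rw [gfw_re])
    have hr : c ≤ ‖gfw c v‖ := (le_abs_self c).trans (gfw_norm_re c v)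
    have h2 := h' _ hr
    have h3 := hK ‖gfw c v‖ (norm_nonneg _)
    rw [abs_of_nonneg hy] at h3
    have him := gfw_norm_im c v
    rw [Real.norm_of_nonneg (by positivity), gfF, norm_mul, Complex.norm_cpow_real, gfq_norm]
    set r := ‖gfw c v‖ with hrdef
    have hr0 : 0 < r := lt_of_lt_of_le hc hr
    have h4 : Real.exp (y * r ^ k) ≤ Real.exp (δ / 2 * r + K) := Real.exp_le_exp.2 h3
    have e : Real.exp (-δ * r) * Real.exp (δ / 2 * r + K) = Real.exp K * Real.exp (-(δ / 2) * r) := by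
      rw [← Real.exp_add, ← Real.exp_add]; ring_nf
    calc _ ≤ B * Real.exp (-δ * r) * r ^ a * Real.exp (δ / 2 * r + K) := by gcongr
      _ = B * r ^ a * (Real.exp (-δ * r) * Real.exp (δ / 2 * r + K)) := by ring
      _ = B * Real.exp K * (r ^ a * Real.exp (-(δ / 2) * r)) := by rw [e]; ring
      _ ≤ B * Real.exp K * (D * Real.exp (-(δ / 2 / 2) * r)) :=
        mul_le_mul_of_nonneg_left h2 (by positivity)
      _ ≤ B * Real.exp K * (D * Real.exp (-(δ / 2 / 2) * |v|)) := by
        refine mul_le_mul_of_nonneg_left (mul_le_mul_of_nonneg_left (Real.exp_le_exp.2 ?_) hD.le)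
          (by positivity)
        nlinarith
      _ = _ := by ring

lemma gf_hankel_int {p : ℝ} (hp1 : 1 < p) (hp2 : p < 2) {c : ℝ} (hc : 0 < c) (s : ℝ) {a : ℝ}
    (ha : a = p - 1 - p * s) :
    ∫ v, gfF p a (gfw c v) = (2 * Real.pi / p : ℂ) * (((Real.Gamma s)⁻¹ : ℝ) : ℂ) := by
  have h := gfHankel_all hp1 hp2 hc s
  unfold gfHankel gfH at h
  have hp0 : (p : ℂ) ≠ 0 := by exact_mod_cast (by linarith : p ≠ 0)
  rw [ha]
  push_cast at h ⊢
  field_simp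
  linear_combination h

lemma gf_mainardi_rep {p : ℝ} (hp1 : 1 < p) (hp2 : p < 2) {L : ℝ} (hL0 : 0 < L) (hpL : p * L < 1)
    (mu : ℝ) {c : ℝ} (hc : 0 < c) {y : ℝ} (hy : 0 ≤ y) :
    (2 * Real.pi / p : ℂ) * (mainardiR L mu y : ℂ)
      = ∫ v, gfF p (p - 1 - p * (mu - L)) (gfw c v) * Complex.exp (-(y * gfq (p * L) c v)) := by
  have hk0 : 0 < p * L := by positivity
  set a := p - 1 - p * (mu - L) with ha
  have hs := hasSum_integral_of_dominated_convergence (μ := volume)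
    (F := fun (n : ℕ) v => ((-y) ^ n / n.factorial : ℂ) * gfF p (a + n * (p * L)) (gfw c v))
    (f := fun v => gfF p a (gfw c v) * Complex.exp (-(y * gfq (p * L) c v)))
    (bound := fun (n : ℕ) v => ‖gfF p a (gfw c v)‖ * ((y * ‖gfq (p * L) c v‖) ^ n / n.factorial))
    ?_ ?_ ?_ ?_ ?_
  · rw [← hs.tsum_eq, mainardiR, Complex.ofReal_tsum, ← tsum_mul_left]
    congr 1
    funext n
    rw [integral_const_mul, gf_hankel_int hp1 hp2 hc (mu - ((n : ℝ) + 1) * L) (by rw [ha]; ring)]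
    push_cast
    rw [div_mul_eq_div_div, div_eq_mul_inv _ (Real.Gamma _ : ℂ)]
    ring
  · exact fun n => ((gfF_continuous p _ hc).const_mul _).aestronglyMeasurable
  · intro n
    refine Filter.Eventually.of_forall fun v => ?_
    try simp only
    rw [← gfF_mul_pow p a (p * L) hc v n, norm_mul, norm_mul, norm_div, norm_pow, norm_pow, norm_neg,
      Complex.norm_real, Real.norm_of_nonneg hy, Complex.norm_natCast, mul_pow]
    exact le_of_eq (by ring)
  · refine Filter.Eventually.of_forall fun v => ?_
    exact (Real.summable_pow_div_factorial _).mul_left _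
  · refine (gfF_exp_integrable hp1 hp2 a hk0 hpL hc hy).congr (Filter.Eventually.of_forall fun v => ?_)
    try simp only
    rw [tsum_mul_left, Real.exp_eq_exp_ℝ, NormedSpace.exp_eq_tsum_div]
  · refine Filter.Eventually.of_forall fun v => ?_
    have h1 : HasSum (fun n : ℕ => (-(y * gfq (p * L) c v)) ^ n / (n.factorial : ℂ))
        (Complex.exp (-(y * gfq (p * L) c v))) := by
      rw [Complex.exp_eq_exp_ℂ]
      exact NormedSpace.expSeries_div_hasSum_exp _
    have h2 := h1.mul_left (gfF p a (gfw c v))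
    refine h2.congr_fun ?_
    intro n
    try simp only
    rw [← gfF_mul_pow p a (p * L) hc v n, ← neg_mul, mul_pow]
    ring

lemma gf_laplace_fourier {q : ℂ} (hq : 0 < q.re) (ξ : ℝ) :
    ∫ y : ℝ, Complex.exp (-(Complex.I * ξ * y)) * Complex.exp (-((|y| : ℝ) * q))
      = 2 * (q / (q ^ 2 + ξ ^ 2)) := by
  have hr1 : (-(Complex.I * ξ + q)).re < 0 := by simpa using hq
  have hr2 : (-(-(Complex.I * ξ) + q)).re < 0 := by simpa using hq
  have n1 : Complex.I * ξ + q ≠ 0 := by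
    intro h; rw [h] at hr1; simp at hr1
  have n2 : -(Complex.I * ξ) + q ≠ 0 := by
    intro h; rw [h] at hr2; simp at hr2
  set f : ℝ → ℂ := fun y => Complex.exp (-(Complex.I * ξ * y)) * Complex.exp (-((|y| : ℝ) * q)) with hf
  have e1 : Set.EqOn f (fun y : ℝ => Complex.exp (-(Complex.I * ξ + q) * y)) (Set.Ioi 0) := by
    intro y hy
    simp only [hf]
    rw [abs_of_pos (Set.mem_Ioi.1 hy), ← Complex.exp_add]
    congr 1; ring
  have e2 : Set.EqOn (fun y => f (-y)) (fun y : ℝ => Complex.exp (-(-(Complex.I * ξ) + q) * y))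
      (Set.Ioi 0) := by
    intro y hy
    simp only [hf]
    rw [abs_neg, abs_of_pos (Set.mem_Ioi.1 hy), ← Complex.exp_add]
    congr 1; push_cast; ring
  have i1 : IntegrableOn f (Set.Ioi 0) :=
    (integrableOn_exp_mul_complex_Ioi hr1 0).congr_fun e1.symm measurableSet_Ioi
  have i2 : IntegrableOn (fun y => f (-y)) (Set.Ioi 0) :=
    (integrableOn_exp_mul_complex_Ioi hr2 0).congr_fun e2.symm measurableSet_Ioi
  have i3 : IntegrableOn f (Set.Iic 0) := by
    rw [integrableOn_Iic_iff_integrableOn_Iio]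
    have := IntegrableOn.comp_neg_Iio (c := 0) (f := fun y => f (-y)) (by simpa using i2)
    simpa using this
  rw [← intervalIntegral.integral_Iic_add_Ioi i3 i1]
  have h3 := integral_comp_neg_Ioi (0 : ℝ) f
  rw [neg_zero] at h3
  rw [← h3, setIntegral_congr_fun measurableSet_Ioi e1, setIntegral_congr_fun measurableSet_Ioi e2,
    integral_exp_mul_complex_Ioi hr1, integral_exp_mul_complex_Ioi hr2]
  simp only [Complex.ofReal_zero, mul_zero, Complex.exp_zero, neg_div_neg_eq]
  have n3 : q ^ 2 + (ξ : ℂ) ^ 2 = (Complex.I * ξ + q) * (-(Complex.I * ξ) + q) := by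
    linear_combination (ξ : ℂ) ^ 2 * Complex.I_sq
  rw [n3]
  field_simp
  ring

lemma gf_swap {p : ℝ} (hp1 : 1 < p) (hp2 : p < 2) {L : ℝ} (hL0 : 0 < L) (hpL : p * L < 1)
    (mu : ℝ) {c : ℝ} (hc : 0 < c) (ξ : ℝ) :
    (2 * Real.pi / p : ℂ) * ∫ y : ℝ, Complex.exp (-(Complex.I * ξ * y)) * (mainardiR L mu |y| : ℂ)
      = ∫ v, gfF p (p - 1 - p * (mu - L)) (gfw c v)
          * (2 * (gfq (p * L) c v / (gfq (p * L) c v ^ 2 + ξ ^ 2))) := by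
  have hk0 : 0 < p * L := by positivity
  set a := p - 1 - p * (mu - L) with ha
  have hκ : 0 < c ^ (p * L) * Real.cos (p * L * (Real.pi / 2)) :=
    mul_pos (by positivity) (gf_cos_pos hk0 hpL)
  set κ := c ^ (p * L) * Real.cos (p * L * (Real.pi / 2)) with hκd
  have hre : ∀ v, κ ≤ (gfq (p * L) c v).re := gfq_re hk0 hpL hc
  set Φ : ℝ → ℝ → ℂ := fun y v => Complex.exp (-(Complex.I * ξ * y)) *
    (gfF p a (gfw c v) * Complex.exp (-((|y| : ℝ) * gfq (p * L) c v))) with hΦ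
  have hPhiInt : Integrable (Function.uncurry Φ) (volume.prod volume) := by
    refine ((gf_integrable_exp_abs hκ).mul_prod (gfF_integrable hp1 hp2 a hc).norm).mono' ?_ ?_
    · refine Continuous.aestronglyMeasurable ?_
      have c1 : Continuous (fun z : ℝ × ℝ => gfF p a (gfw c z.2)) :=
        (gfF_continuous p a hc).comp continuous_snd
      have c2 : Continuous (fun z : ℝ × ℝ => gfq (p * L) c z.2) :=
        (gfq_cont (p * L) hc).comp continuous_snd
      simp only [Function.uncurry_def, hΦ]
      fun_prop
    · refine Filter.Eventually.of_forall fun z => ?_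
      simp only [Function.uncurry_def, hΦ]
      rw [norm_mul, norm_mul, Complex.norm_exp, Complex.norm_exp]
      have e1 : (-(Complex.I * ξ * z.1)).re = 0 := by simp
      have e2 : (-((|z.1| : ℝ) * gfq (p * L) c z.2)).re = -(|z.1| * (gfq (p * L) c z.2).re) := by
        rw [Complex.neg_re, Complex.re_ofReal_mul]
      rw [e1, e2, Real.exp_zero, one_mul, mul_comm]
      refine mul_le_mul_of_nonneg_right (Real.exp_le_exp.2 ?_) (norm_nonneg _)
      nlinarith [hre z.2, abs_nonneg z.1]
  rw [← integral_const_mul]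
  calc _ = ∫ y : ℝ, ∫ v : ℝ, Φ y v := by
        congr 1
        funext y
        simp only [hΦ]
        rw [integral_const_mul, ← gf_mainardi_rep hp1 hp2 hL0 hpL mu hc (abs_nonneg y)]
        ring
    _ = ∫ v : ℝ, ∫ y : ℝ, Φ y v := integral_integral_swap hPhiInt
    _ = _ := by
        congr 1
        funext v
        rw [← gf_laplace_fourier (lt_of_lt_of_le hκ (hre v)) ξ, ← integral_const_mul]
        congr 1
        funext y
        simp only [hΦ]
        ring

lemma gf_ml {p : ℝ} (hp1 : 1 < p) (hp2 : p < 2) {L : ℝ} (hL0 : 0 < L)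
    (mu : ℝ) {c : ℝ} (hc : 0 < c) (ξ : ℝ) (hcξ : |ξ| < c ^ (p * L)) :
    ∫ v, gfF p (p - 1 - p * (mu - L)) (gfw c v)
          * (2 * (gfq (p * L) c v / (gfq (p * L) c v ^ 2 + ξ ^ 2)))
      = (2 * Real.pi / p : ℂ) * (2 * (mittagLeffler (2 * L) mu (-(ξ ^ 2)) : ℂ)) := by
  have hk0 : 0 < p * L := by positivity
  set a := p - 1 - p * (mu - L) with ha
  set R := c ^ (p * L) with hR
  have hR0 : 0 < R := by positivity
  set ρ := ξ ^ 2 / R ^ 2 with hρ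
  have hρ0 : 0 ≤ ρ := by positivity
  have hρ1 : ρ < 1 := by
    rw [hρ, div_lt_one (by positivity), ← sq_abs]
    have := abs_nonneg ξ
    nlinarith
  have hqR : ∀ v, R ≤ ‖gfq (p * L) c v‖ := fun v => by
    rw [gfq_norm]
    exact Real.rpow_le_rpow hc.le ((le_abs_self c).trans (gfw_norm_re c v)) hk0.le
  have hratio : ∀ v, ‖(-((ξ : ℂ) ^ 2)) * ((gfq (p * L) c v)⁻¹) ^ 2‖ ≤ ρ := fun v => by
    rw [norm_mul, norm_neg, norm_pow, norm_pow, norm_inv, Complex.norm_real, Real.norm_eq_abs, sq_abs,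
      hρ, div_eq_mul_inv, ← inv_pow]
    have := hqR v
    gcongr
  have hs := hasSum_integral_of_dominated_convergence (μ := volume)
    (F := fun (n : ℕ) v => (2 * (-((ξ : ℂ) ^ 2)) ^ n) * gfF p (a - (2 * n + 1 : ℕ) * (p * L)) (gfw c v))
    (f := fun v => gfF p a (gfw c v)
          * (2 * (gfq (p * L) c v / (gfq (p * L) c v ^ 2 + ξ ^ 2))))
    (bound := fun (n : ℕ) v => 2 * ‖gfF p (a - (1 : ℕ) * (p * L)) (gfw c v)‖ * ρ ^ n)
    ?_ ?_ ?_ ?_ ?_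
  · rw [← hs.tsum_eq, mittagLeffler, Complex.ofReal_tsum, ← tsum_mul_left, ← tsum_mul_left]
    congr 1
    funext n
    rw [integral_const_mul, gf_hankel_int hp1 hp2 hc (2 * L * n + mu) (by rw [ha]; push_cast; ring)]
    push_cast
    rw [div_eq_mul_inv _ (Real.Gamma _ : ℂ)]
    ring
  · exact fun n => ((gfF_continuous p _ hc).const_mul _).aestronglyMeasurable
  · intro n
    refine Filter.Eventually.of_forall fun v => ?_
    try simp only
    have e : (2 * (-((ξ : ℂ) ^ 2)) ^ n) * gfF p (a - (2 * n + 1 : ℕ) * (p * L)) (gfw c v)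
        = 2 * gfF p (a - (1 : ℕ) * (p * L)) (gfw c v)
          * ((-((ξ : ℂ) ^ 2)) * ((gfq (p * L) c v)⁻¹) ^ 2) ^ n := by
      rw [← gfF_mul_inv_pow p a (p * L) hc v, ← gfF_mul_inv_pow p a (p * L) hc v, mul_pow, ← pow_mul,
        pow_add]
      ring
    rw [e, norm_mul, norm_mul, norm_pow]
    have := hratio v
    simp only [Complex.norm_ofNat]
    gcongr
  · refine Filter.Eventually.of_forall fun v => ?_
    exact (summable_geometric_of_lt_one hρ0 hρ1).mul_left _
  · simp only [tsum_mul_left]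
    exact ((gfF_integrable hp1 hp2 _ hc).norm.const_mul 2).mul_const _
  · refine Filter.Eventually.of_forall fun v => ?_
    have h1 := hasSum_geometric_of_norm_lt_one ((hratio v).trans_lt hρ1)
    have h2 := h1.mul_left (2 * gfF p (a - (1 : ℕ) * (p * L)) (gfw c v))
    have hq0 := gfq_ne (p * L) hc v
    have hne : 1 - (-((ξ : ℂ) ^ 2)) * ((gfq (p * L) c v)⁻¹) ^ 2 ≠ 0 := by
      intro h
      have h3 := (hratio v).trans_lt hρ1
      rw [← sub_eq_zero.1 h] at h3
      simp at h3
    have hval : 2 * gfF p (a - (1 : ℕ) * (p * L)) (gfw c v)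
        * (1 - (-((ξ : ℂ) ^ 2)) * ((gfq (p * L) c v)⁻¹) ^ 2)⁻¹
        = gfF p a (gfw c v) * (2 * (gfq (p * L) c v / (gfq (p * L) c v ^ 2 + ξ ^ 2))) := by
      rw [← gfF_mul_inv_pow p a (p * L) hc v]
      have e : 1 - (-((ξ : ℂ) ^ 2)) * ((gfq (p * L) c v)⁻¹) ^ 2
          = (gfq (p * L) c v ^ 2 + ξ ^ 2) / gfq (p * L) c v ^ 2 := by
        field_simp
        ring
      rw [e] at hne ⊢
      have hne2 := (div_ne_zero_iff.1 hne).1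
      field_simp
    rw [hval] at h2
    refine h2.congr_fun ?_
    intro n
    try simp only
    rw [← gfF_mul_inv_pow p a (p * L) hc v, ← gfF_mul_inv_pow p a (p * L) hc v, mul_pow, ← pow_mul,
      pow_add]
    ring

lemma gf_unit {L : ℝ} (hL0 : 0 < L) (hL1 : L < 1) (mu ξ : ℝ) :
    ∫ y : ℝ, Complex.exp (-(Complex.I * ξ * y)) * (mainardiR L mu |y| : ℂ)
      = 2 * (mittagLeffler (2 * L) mu (-(ξ ^ 2)) : ℂ) := by
  obtain ⟨p, hp1, hp'⟩ := exists_between (lt_min one_lt_two ((one_lt_div hL0).2 hL1))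
  have hp2 : p < 2 := hp'.trans_le (min_le_left _ _)
  have hpL : p * L < 1 := (lt_div_iff₀ hL0).1 (hp'.trans_le (min_le_right _ _))
  have hk0 : 0 < p * L := by positivity
  have hx : 0 < |ξ| + 1 := by positivity
  have hc : 0 < (|ξ| + 1) ^ (1 / (p * L)) := by positivity
  have hcξ : |ξ| < ((|ξ| + 1) ^ (1 / (p * L))) ^ (p * L) := by
    rw [← Real.rpow_mul hx.le, one_div, inv_mul_cancel₀ hk0.ne', Real.rpow_one]
    linarith
  have h := (gf_swap hp1 hp2 hL0 hpL mu hc ξ).trans (gf_ml hp1 hp2 hL0 mu hc ξ hcξ)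
  refine mul_left_cancel₀ ?_ h
  have hp0 : (p : ℂ) ≠ 0 := by exact_mod_cast (by linarith : p ≠ 0)
  have hpi : (Real.pi : ℂ) ≠ 0 := by exact_mod_cast Real.pi_pos.ne'
  exact div_ne_zero (mul_ne_zero two_ne_zero hpi) hp0

/-- the Fourier transform of the Green function is
`∫_ℝ e^{−iξx} G_β(t,x) dx = t^{⌈β⌉−1} E_{β,⌈β⌉}(−t^β ξ²)` for `β ∈ (0,2)`, `t > 0`. -/
theorem greenG_fourier (β : ℝ) (hβ0 : 0 < β) (hβ2 : β < 2) (t : ℝ) (ht : 0 < t) (ξ : ℝ) :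
    ∫ x : ℝ, Complex.exp (-(Complex.I * (ξ : ℂ) * (x : ℂ))) * (greenG β t x : ℂ)
      = ((t ^ ((⌈β⌉₊ : ℝ) - 1) : ℝ) : ℂ)
          * ((mittagLeffler β (⌈β⌉₊ : ℝ) (-(t ^ β * ξ ^ 2)) : ℝ) : ℂ) := by
  have hT : 0 < t ^ (β / 2) := by positivity
  set T := t ^ (β / 2) with hTd
  set mu := (⌈β⌉₊ : ℝ) with hmu
  have h := gf_unit (L := β / 2) (by linarith) (by linarith) mu (T * ξ)
  have hz : -((T * ξ) ^ 2) = -(t ^ β * ξ ^ 2) := by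
    rw [mul_pow, hTd, ← Real.rpow_natCast, ← Real.rpow_mul ht.le]
    congr 3
    push_cast; ring
  rw [hz, mul_div_cancel₀ β two_ne_zero] at h
  have hsub := Measure.integral_comp_mul_left
    (fun x : ℝ => Complex.exp (-(Complex.I * (ξ : ℂ) * (x : ℂ))) * (greenG β t x : ℂ)) T
  rw [abs_of_pos (inv_pos.2 hT)] at hsub
  have hl : ∫ x : ℝ, Complex.exp (-(Complex.I * (ξ : ℂ) * ((T * x : ℝ) : ℂ))) * (greenG β t (T * x) : ℂ)
      = ((t ^ (mu - 1 - β / 2) / 2 : ℝ) : ℂ) * ∫ y : ℝ,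
        Complex.exp (-(Complex.I * ((T * ξ : ℝ) : ℂ) * y)) * (mainardiR (β / 2) mu |y| : ℂ) := by
    rw [← integral_const_mul]
    congr 1
    funext y
    have e : |T * y| / t ^ (β / 2) = |y| := by
      rw [abs_mul, abs_of_pos hT, ← hTd, mul_div_cancel_left₀ _ hT.ne']
    simp only [greenG]
    rw [e, ← hmu]
    push_cast
    ring_nf
  rw [hl, h, Complex.real_smul] at hsub
  have hT' : (T : ℂ) ≠ 0 := by exact_mod_cast hT.ne'
  have e3 : t ^ (mu - 1) = T * t ^ (mu - 1 - β / 2) := by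
    rw [hTd, ← Real.rpow_add ht]; ring_nf
  rw [e3]
  have h4 := congrArg (fun z => (T : ℂ) * z) hsub
  simp only [← mul_assoc] at h4
  rw [Complex.ofReal_inv, mul_inv_cancel₀ hT', one_mul] at h4
  rw [← h4]
  push_cast
  ring
end

section
/- Let β ∈ (0,1). There exists a finite constant C = C(β) > 0 such that for all t > 0 and all x, y ∈ ℝ, ∫_0^t ∫_ℝ (G_β(t−r, x−z) − G_β(t−r, y−z))² dz dr ≤ C · t^{1−β} · |x − y|. -/
open MeasureTheory

open Complex in
theorem gsi_exp_sub_one (w : ℂ) (hw : w.re ≤ 0) : ‖Complex.exp w - 1‖ ≤ ‖w‖ := by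
  have h := Convex.norm_image_sub_le_of_norm_hasDerivWithin_le (𝕜 := ℂ) (f := Complex.exp)
    (f' := Complex.exp) (s := {z : ℂ | z.re ≤ 0}) (x := 0) (y := w) (C := 1)
    (fun x _ => (Complex.hasDerivAt_exp x).hasDerivWithinAt)
    (fun x hx => by
      rw [Complex.norm_exp]
      exact Real.exp_le_one_iff.mpr hx)
    (convex_halfSpace_re_le 0) (by simp) hw
  simpa using h

theorem gsi_exp_sub_one_sqrt (w : ℂ) (hw : w.re ≤ 0) :
    ‖Complex.exp w - 1‖ ≤ Real.sqrt (2 * ‖w‖) := by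
  have h1 := gsi_exp_sub_one w hw
  have h2 : ‖Complex.exp w - 1‖ ≤ 2 := by
    refine (norm_sub_le _ _).trans ?_
    rw [Complex.norm_exp, norm_one]
    linarith [Real.exp_le_one_iff.mpr hw]
  apply Real.le_sqrt_of_sq_le
  nlinarith [norm_nonneg (Complex.exp w - 1), norm_nonneg w]

theorem gsi_inv_Gamma (s : ℝ) (hs : 0 < s) :
    (Real.Gamma (1 - s))⁻¹ = Real.Gamma s * Real.sin (Real.pi * s) / Real.pi := by
  have h := Real.Gamma_mul_Gamma_one_sub s
  have h0 := (Real.Gamma_pos_of_pos hs).ne'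
  have h1 : Real.Gamma (1 - s) = Real.pi / Real.sin (Real.pi * s) / Real.Gamma s := by
    rw [← h]; field_simp
  rw [h1, inv_div, div_div_eq_mul_div]

/-- The unimodular number `exp (i π lam)`. -/
noncomputable def gsiOm (lam : ℝ) : ℂ := Complex.exp ((Real.pi * lam : ℝ) * Complex.I)

/-- The integrand in the integral representation of the Mainardi function. -/
noncomputable def gsiK (lam z ρ : ℝ) : ℝ :=
  Real.pi⁻¹ * (Real.exp (-ρ) * ρ ^ (lam - 1)) *
    (gsiOm lam * Complex.exp (-((z * ρ ^ lam : ℝ) : ℂ) * gsiOm lam)).im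

theorem gsiOm_norm (lam : ℝ) : ‖gsiOm lam‖ = 1 := Complex.norm_exp_ofReal_mul_I _

theorem gsiOm_re (lam : ℝ) : (gsiOm lam).re = Real.cos (Real.pi * lam) :=
  Complex.exp_ofReal_mul_I_re _

theorem gsiOm_pow_im (lam : ℝ) (n : ℕ) :
    (gsiOm lam ^ n).im = Real.sin (Real.pi * (n * lam)) := by
  rw [gsiOm, ← Complex.exp_nat_mul, ← Complex.exp_ofReal_mul_I_im]
  congr 2; push_cast; ring

theorem gsi_hasSum_pt (lam z ρ : ℝ) (hρ : 0 < ρ) :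
    HasSum (fun n : ℕ => (-z) ^ n / (n.factorial : ℝ) *
      (Real.sin (Real.pi * (((n : ℝ) + 1) * lam)) / Real.pi) *
        (Real.exp (-ρ) * ρ ^ (((n : ℝ) + 1) * lam - 1))) (gsiK lam z ρ) := by
  have h := NormedSpace.expSeries_div_hasSum_exp (-((z * ρ ^ lam : ℝ) : ℂ) * gsiOm lam)
  rw [← Complex.exp_eq_exp_ℂ] at h
  have h2 := (Complex.hasSum_im (h.mul_left (gsiOm lam))).mul_left
    (Real.pi⁻¹ * (Real.exp (-ρ) * ρ ^ (lam - 1)))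
  refine HasSum.congr_fun (h2) fun n => ?_
  have e1 : gsiOm lam * ((-((z * ρ ^ lam : ℝ) : ℂ) * gsiOm lam) ^ n / (n.factorial : ℂ)) =
      (((-(z * ρ ^ lam)) ^ n / (n.factorial : ℝ) : ℝ) : ℂ) * gsiOm lam ^ (n + 1) := by
    push_cast; ring
  rw [e1, Complex.im_ofReal_mul, gsiOm_pow_im]
  have e2 : ρ ^ (((n : ℝ) + 1) * lam - 1) = ρ ^ (lam - 1) * (ρ ^ lam) ^ n := by
    rw [← Real.rpow_mul_natCast hρ.le, ← Real.rpow_add hρ]; congr 1; ring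
  rw [e2]
  push_cast
  rw [neg_mul_eq_neg_mul, mul_pow]
  ring

theorem gsi_bound_integrable (lam z : ℝ) (h0 : 0 < lam) (h1 : lam < 1 / 2) (hz : 0 ≤ z) :
    IntegrableOn (fun ρ : ℝ => Real.exp (z * ρ ^ lam) * (Real.exp (-ρ) * ρ ^ (lam - 1)))
      (Set.Ioi 0) := by
  have hi := (integrableOn_rpow_mul_exp_neg_mul_rpow (p := 1) (s := lam - 1) (b := 1 / 2)
    (by linarith) one_pos (by norm_num)).const_mul (Real.exp (z + z ^ 2 / 2))
  refine Integrable.mono' hi ?_ ?_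
  · apply Measurable.aestronglyMeasurable
    fun_prop
  · filter_upwards [ae_restrict_mem measurableSet_Ioi] with ρ hρ
    have hρ : 0 < ρ := hρ
    have hp : 0 ≤ ρ ^ (lam - 1) := (Real.rpow_pos_of_pos hρ _).le
    rw [Real.norm_of_nonneg (by positivity), Real.rpow_one, ← mul_assoc, ← Real.exp_add,
      mul_left_comm, ← Real.exp_add, mul_comm]
    refine mul_le_mul_of_nonneg_left (Real.exp_le_exp.mpr ?_) hp
    have hle : ρ ^ lam ≤ 1 + Real.sqrt ρ := by
      rcases le_total ρ 1 with h | h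
      · have := Real.rpow_le_one hρ.le h h0.le
        linarith [Real.sqrt_nonneg ρ]
      · have := Real.rpow_le_rpow_of_exponent_le h h1.le
        rw [← Real.sqrt_eq_rpow] at this
        linarith
    nlinarith [mul_le_mul_of_nonneg_left hle hz, sq_nonneg (z - Real.sqrt ρ), Real.sq_sqrt hρ.le]

theorem gsi_repr (lam z : ℝ) (h0 : 0 < lam) (h1 : lam < 1 / 2) (hz : 0 ≤ z) :
    mainardiR lam 1 z = ∫ ρ in Set.Ioi (0 : ℝ), gsiK lam z ρ := by
  have hb : ∀ ρ : ℝ, 0 < ρ → HasSum (fun n : ℕ => z ^ n / (n.factorial : ℝ) *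
        (Real.exp (-ρ) * ρ ^ (((n : ℝ) + 1) * lam - 1)))
        (Real.exp (z * ρ ^ lam) * (Real.exp (-ρ) * ρ ^ (lam - 1))) := by
    intro ρ hρ
    have h := NormedSpace.expSeries_div_hasSum_exp (z * ρ ^ lam)
    rw [← Real.exp_eq_exp_ℝ] at h
    refine HasSum.congr_fun (h.mul_right (Real.exp (-ρ) * ρ ^ (lam - 1))) fun n => ?_
    have e2 : ρ ^ (((n : ℝ) + 1) * lam - 1) = ρ ^ (lam - 1) * (ρ ^ lam) ^ n := by
      rw [← Real.rpow_mul_natCast hρ.le, ← Real.rpow_add hρ]; congr 1; ring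
    rw [e2, mul_pow]; ring
  have key := hasSum_integral_of_dominated_convergence (μ := volume.restrict (Set.Ioi (0 : ℝ)))
    (F := fun (n : ℕ) ρ => (-z) ^ n / (n.factorial : ℝ) *
      (Real.sin (Real.pi * (((n : ℝ) + 1) * lam)) / Real.pi) *
        (Real.exp (-ρ) * ρ ^ (((n : ℝ) + 1) * lam - 1))) (f := gsiK lam z)
    (fun n ρ => z ^ n / (n.factorial : ℝ) *
        (Real.exp (-ρ) * ρ ^ (((n : ℝ) + 1) * lam - 1)))
    (fun n => by
      apply Measurable.aestronglyMeasurable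
      fun_prop)
    (fun n => by
      filter_upwards [ae_restrict_mem measurableSet_Ioi] with ρ hρ
      have hρ : 0 < ρ := hρ
      have hp : 0 ≤ ρ ^ (((n : ℝ) + 1) * lam - 1) := (Real.rpow_pos_of_pos hρ _).le
      rw [norm_mul, Real.norm_of_nonneg (mul_nonneg (Real.exp_pos _).le hp)]
      refine mul_le_mul_of_nonneg_right ?_ (by positivity)
      rw [norm_mul, norm_div, norm_pow, norm_neg, Real.norm_of_nonneg hz, Real.norm_natCast]
      refine mul_le_of_le_one_right (by positivity) ?_
      rw [norm_div, Real.norm_of_nonneg Real.pi_pos.le, div_le_one Real.pi_pos]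
      exact (Real.abs_sin_le_one _).trans (by linarith [Real.pi_gt_three]))
    (by
      filter_upwards [ae_restrict_mem measurableSet_Ioi] with ρ hρ
      exact (hb ρ hρ).summable)
    (by
      refine (gsi_bound_integrable lam z h0 h1 hz).congr ?_
      filter_upwards [ae_restrict_mem measurableSet_Ioi] with ρ hρ
      exact (hb ρ hρ).tsum_eq.symm)
    (by
      filter_upwards [ae_restrict_mem measurableSet_Ioi] with ρ hρ
      exact gsi_hasSum_pt lam z ρ hρ)
  rw [← key.tsum_eq, mainardiR]
  congr 1
  funext n
  have hn : 0 < ((n : ℝ) + 1) * lam := by positivity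
  rw [integral_const_mul, ← Real.Gamma_eq_integral hn, div_mul_eq_div_div, div_eq_mul_inv,
    gsi_inv_Gamma _ hn]
  ring

theorem gsiK_measurable (lam z : ℝ) : Measurable (gsiK lam z) := by
  unfold gsiK
  have : Measurable (fun ρ : ℝ => Complex.exp (-((z * ρ ^ lam : ℝ) : ℂ) * gsiOm lam)) := by
    fun_prop
  have h2 := Complex.measurable_im.comp (this.const_mul (gsiOm lam))
  exact (Measurable.const_mul (by fun_prop) _).mul h2

theorem gsi_cos_pos (lam : ℝ) (h0 : 0 < lam) (h1 : lam < 1 / 2) :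
    0 < Real.cos (Real.pi * lam) := by
  apply Real.cos_pos_of_mem_Ioo
  constructor <;> nlinarith [Real.pi_pos]

theorem gsiK_integrable (lam z : ℝ) (h0 : 0 < lam) (h1 : lam < 1 / 2) (hz : 0 ≤ z) :
    IntegrableOn (gsiK lam z) (Set.Ioi 0) := by
  have hc := gsi_cos_pos lam h0 h1
  refine Integrable.mono' ((Real.GammaIntegral_convergent h0).const_mul Real.pi⁻¹)
    (gsiK_measurable lam z).aestronglyMeasurable ?_
  filter_upwards [ae_restrict_mem measurableSet_Ioi] with ρ hρ
  have hρ : 0 < ρ := hρ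
  have hp : 0 ≤ ρ ^ (lam - 1) := (Real.rpow_pos_of_pos hρ _).le
  have hq : 0 ≤ ρ ^ lam := (Real.rpow_pos_of_pos hρ _).le
  have hpi := Real.pi_pos
  rw [gsiK, norm_mul, Real.norm_of_nonneg (by positivity)]
  refine mul_le_of_le_one_right (by positivity) ?_
  refine (Complex.abs_im_le_norm _).trans ?_
  rw [norm_mul, gsiOm_norm, one_mul, Complex.norm_exp, ← Complex.ofReal_neg,
    Complex.re_ofReal_mul, gsiOm_re]
  apply Real.exp_le_one_iff.mpr
  have : 0 ≤ z * ρ ^ lam * Real.cos (Real.pi * lam) := by positivity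
  linarith

theorem gsi_hoelder (lam : ℝ) (h0 : 0 < lam) (h1 : lam < 1 / 2) :
    ∃ K : ℝ, 0 < K ∧ ∀ a b : ℝ, 0 ≤ a → a ≤ b →
      |mainardiR lam 1 a - mainardiR lam 1 b| ≤ K * Real.sqrt (b - a) / (1 + a) := by
  have hc := gsi_cos_pos lam h0 h1
  set c := Real.cos (Real.pi * lam) with hcdef
  have hpi := Real.pi_pos
  have hG1 : 0 < Real.Gamma (3 * lam / 2) := Real.Gamma_pos_of_pos (by positivity)
  have hG2 : 0 < Real.Gamma (lam / 2) := Real.Gamma_pos_of_pos (by positivity)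
  refine ⟨Real.pi⁻¹ * Real.sqrt 2 * (Real.Gamma (3 * lam / 2) + c⁻¹ * Real.Gamma (lam / 2)),
    by positivity, ?_⟩
  intro a b ha hab
  have hb := ha.trans hab
  rw [gsi_repr lam a h0 h1 ha, gsi_repr lam b h0 h1 hb,
    ← integral_sub (gsiK_integrable lam a h0 h1 ha) (gsiK_integrable lam b h0 h1 hb)]
  have i1 := Real.GammaIntegral_convergent (s := 3 * lam / 2) (by positivity)
  have i2 := (Real.GammaIntegral_convergent (s := lam / 2) (by positivity)).const_mul c⁻¹
  have i3 := (i1.add i2).const_mul (Real.pi⁻¹ * Real.sqrt 2 * Real.sqrt (b - a) / (1 + a))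
  have hle := norm_integral_le_of_norm_le (f := fun ρ => gsiK lam a ρ - gsiK lam b ρ) i3 ?_
  · rw [Real.norm_eq_abs] at hle
    refine hle.trans_eq ?_
    simp only [Pi.add_apply]
    rw [integral_const_mul, integral_add i1 i2, integral_const_mul,
      ← Real.Gamma_eq_integral (by positivity), ← Real.Gamma_eq_integral (by positivity)]
    ring
  filter_upwards [ae_restrict_mem measurableSet_Ioi] with ρ hρ
  have hρ : 0 < ρ := hρ
  have hp : 0 ≤ ρ ^ (lam - 1) := (Real.rpow_pos_of_pos hρ _).le
  have hq : 0 < ρ ^ lam := Real.rpow_pos_of_pos hρ _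
  have hq2 : 0 < ρ ^ (lam / 2) := Real.rpow_pos_of_pos hρ _
  simp only [Pi.add_apply]
  rw [gsiK, gsiK, ← mul_sub, ← Complex.sub_im, norm_mul, Real.norm_of_nonneg (by positivity)]
  set q := ρ ^ lam with hqdef
  have hfac : gsiOm lam * Complex.exp (-((a * q : ℝ) : ℂ) * gsiOm lam) -
      gsiOm lam * Complex.exp (-((b * q : ℝ) : ℂ) * gsiOm lam) =
      - (gsiOm lam * Complex.exp (-((a * q : ℝ) : ℂ) * gsiOm lam) *
        (Complex.exp (((-((b - a) * q) : ℝ) : ℂ) * gsiOm lam) - 1)) := by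
    have : Complex.exp (-((b * q : ℝ) : ℂ) * gsiOm lam) =
        Complex.exp (-((a * q : ℝ) : ℂ) * gsiOm lam) *
          Complex.exp (((-((b - a) * q) : ℝ) : ℂ) * gsiOm lam) := by
      rw [← Complex.exp_add]; congr 1; push_cast; ring
    rw [this]; ring
  have hn : ‖(gsiOm lam * Complex.exp (-((a * q : ℝ) : ℂ) * gsiOm lam) -
      gsiOm lam * Complex.exp (-((b * q : ℝ) : ℂ) * gsiOm lam)).im‖ ≤
      Real.exp (-(a * q * c)) * (Real.sqrt 2 * Real.sqrt (b - a) * ρ ^ (lam / 2)) := by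
    refine (Complex.abs_im_le_norm _).trans ?_
    rw [hfac, norm_neg, norm_mul, norm_mul, gsiOm_norm, one_mul, Complex.norm_exp,
      ← Complex.ofReal_neg, Complex.re_ofReal_mul, gsiOm_re, neg_mul]
    refine mul_le_mul_of_nonneg_left ?_ (Real.exp_pos _).le
    have hnn : 0 ≤ (b - a) * q := mul_nonneg (by linarith) hq.le
    refine (gsi_exp_sub_one_sqrt _ ?_).trans_eq ?_
    · rw [Complex.re_ofReal_mul, gsiOm_re, neg_mul, neg_nonpos]
      exact mul_nonneg hnn hc.le
    · rw [norm_mul, gsiOm_norm, mul_one, Complex.norm_real, norm_neg, Real.norm_of_nonneg hnn,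
        Real.sqrt_mul (by norm_num), Real.sqrt_mul (by linarith), hqdef, Real.sqrt_eq_rpow (ρ ^ lam),
        ← Real.rpow_mul hρ.le, mul_assoc]
      congr 3; ring
  have hexp : (1 + a) * Real.exp (-(a * q * c)) ≤ 1 + c⁻¹ * q⁻¹ := by
    have hx : 0 ≤ a * q * c := by positivity
    have e1 : Real.exp (-(a * q * c)) ≤ 1 := Real.exp_le_one_iff.mpr (by linarith)
    have e2 : (a * q * c) * Real.exp (-(a * q * c)) ≤ 1 := by
      rw [Real.exp_neg, ← div_eq_mul_inv, div_le_one (Real.exp_pos _)]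
      linarith [Real.add_one_le_exp (a * q * c)]
    have e3 : a * Real.exp (-(a * q * c)) =
        (c⁻¹ * q⁻¹) * ((a * q * c) * Real.exp (-(a * q * c))) := by
      field_simp
    have e4 : (c⁻¹ * q⁻¹) * ((a * q * c) * Real.exp (-(a * q * c))) ≤ (c⁻¹ * q⁻¹) * 1 :=
      mul_le_mul_of_nonneg_left e2 (by positivity)
    linarith
  have hexp' : Real.exp (-(a * q * c)) ≤ (1 + c⁻¹ * q⁻¹) / (1 + a) := by
    rw [le_div_iff₀ (by linarith)]; linarith
  refine (mul_le_mul_of_nonneg_left (hn.trans (mul_le_mul_of_nonneg_right hexp' (by positivity)))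
    (by positivity)).trans_eq ?_
  have p1 : ρ ^ (3 * lam / 2 - 1) = ρ ^ (lam - 1) * ρ ^ (lam / 2) := by
    rw [← Real.rpow_add hρ]; congr 1; ring
  have p2 : ρ ^ (lam / 2 - 1) = ρ ^ (lam - 1) * ρ ^ (lam / 2) * q⁻¹ := by
    rw [hqdef, ← Real.rpow_neg hρ.le, ← Real.rpow_add hρ, ← Real.rpow_add hρ]; congr 1; ring
  rw [p1, p2]
  ring

theorem gsi_pt (lam : ℝ) (h0 : 0 < lam) (h1 : lam < 1 / 2) :
    ∃ K : ℝ, 0 < K ∧ ∀ u v : ℝ,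
      (mainardiR lam 1 |u| - mainardiR lam 1 |v|) ^ 2 ≤
        K * |u - v| * ((1 + u ^ 2)⁻¹ + (1 + v ^ 2)⁻¹) := by
  obtain ⟨K, hK, H⟩ := gsi_hoelder lam h0 h1
  refine ⟨K ^ 2, by positivity, ?_⟩
  have main : ∀ u v : ℝ, |u| ≤ |v| → (mainardiR lam 1 |u| - mainardiR lam 1 |v|) ^ 2 ≤
        K ^ 2 * |u - v| * ((1 + u ^ 2)⁻¹ + (1 + v ^ 2)⁻¹) := by
    intro u v huv
    have h := H |u| |v| (abs_nonneg u) huv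
    have h2 := pow_le_pow_left₀ (abs_nonneg _) h 2
    rw [sq_abs, div_pow, mul_pow, Real.sq_sqrt (by linarith)] at h2
    refine h2.trans ?_
    have h3 : |v| - |u| ≤ |u - v| := by
      rw [abs_sub_comm]; exact abs_sub_abs_le_abs_sub v u
    have h4 : ((1 + |u|) ^ 2)⁻¹ ≤ (1 + u ^ 2)⁻¹ + (1 + v ^ 2)⁻¹ := by
      have : ((1 + |u|) ^ 2)⁻¹ ≤ (1 + u ^ 2)⁻¹ := by
        apply inv_anti₀ (by positivity)
        nlinarith [abs_nonneg u, sq_abs u]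
      have : 0 ≤ (1 + v ^ 2)⁻¹ := by positivity
      linarith
    rw [div_eq_mul_inv]
    gcongr
  intro u v
  rcases le_total |u| |v| with h | h
  · exact main u v h
  · have := main v u h
    rw [abs_sub_comm u v, add_comm, sub_sq_comm]
    exact this

theorem gsi_one_int (x s : ℝ) (hs : 0 < s) :
    Integrable (fun z : ℝ => (1 + ((x - z) / s) ^ 2)⁻¹) ∧
      ∫ z : ℝ, (1 + ((x - z) / s) ^ 2)⁻¹ = s * Real.pi := by
  constructor
  · exact (integrable_inv_one_add_sq.comp_div hs.ne').comp_sub_left x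
  · rw [integral_sub_left_eq_self (fun z : ℝ => (1 + (z / s) ^ 2)⁻¹) volume x,
      Measure.integral_comp_div (fun z : ℝ => (1 + z ^ 2)⁻¹), integral_univ_inv_one_add_sq,
      abs_of_pos hs, smul_eq_mul]

theorem gsi_inner (β : ℝ) (hβ0 : 0 < β) (hβ1 : β < 1) :
    ∃ K : ℝ, 0 < K ∧ ∀ s : ℝ, 0 < s → ∀ x y : ℝ,
      (∫ z : ℝ, (greenG β s (x - z) - greenG β s (y - z)) ^ 2) ≤ K * |x - y| * s ^ (-β) := by
  obtain ⟨K, hK, H⟩ := gsi_pt (β / 2) (by linarith) (by linarith)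
  refine ⟨K * Real.pi / 2, by positivity, ?_⟩
  intro s hs x y
  have hceil : ⌈β⌉₊ = 1 := by
    rw [Nat.ceil_eq_iff one_ne_zero]; constructor <;> norm_num <;> linarith
  set l := s ^ (β / 2) with hl
  have hlpos : 0 < l := Real.rpow_pos_of_pos hs _
  have hG : ∀ w, greenG β s w = l⁻¹ / 2 * mainardiR (β / 2) 1 |w / l| := by
    intro w
    rw [greenG, hceil, abs_div, abs_of_pos hlpos, hl, ← Real.rpow_neg hs.le]
    norm_num
  obtain ⟨ix, ex⟩ := gsi_one_int x l hlpos
  obtain ⟨iy, ey⟩ := gsi_one_int y l hlpos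
  have hmono := integral_mono_of_nonneg (μ := volume)
    (f := fun z : ℝ => (greenG β s (x - z) - greenG β s (y - z)) ^ 2)
    (Filter.Eventually.of_forall fun z => sq_nonneg _)
    ((ix.add iy).const_mul ((l⁻¹ / 2) ^ 2 * (K * (|x - y| / l))))
    (Filter.Eventually.of_forall fun z => by
      simp only [Pi.add_apply]
      rw [hG, hG, ← mul_sub, mul_pow, mul_assoc]
      refine mul_le_mul_of_nonneg_left ?_ (sq_nonneg _)
      refine (H _ _).trans_eq ?_
      rw [← sub_div, abs_div, abs_of_pos hlpos]
      congr 4; ring)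
  refine hmono.trans_eq ?_
  simp only [Pi.add_apply]
  rw [integral_const_mul, integral_add ix iy, ex, ey]
  have hs2 : s ^ (-β) = l⁻¹ ^ 2 := by
    rw [hl, ← Real.rpow_neg hs.le, ← Real.rpow_mul_natCast hs.le]; congr 1; push_cast; ring
  rw [hs2]
  field_simp
  ring

theorem greenG_space_increment (β : ℝ) (hβ0 : 0 < β) (hβ1 : β < 1) :
    ∃ C : ℝ, 0 < C ∧
      ∀ t : ℝ, 0 < t → ∀ x y : ℝ,
        (∫ r in Set.Ioc (0 : ℝ) t, ∫ z : ℝ,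
            (greenG β (t - r) (x - z) - greenG β (t - r) (y - z)) ^ 2)
          ≤ C * t ^ (1 - β) * |x - y| := by
  obtain ⟨K, hK, H⟩ := gsi_inner β hβ0 hβ1
  refine ⟨K / (1 - β), div_pos hK (by linarith), ?_⟩
  intro t ht x y
  have hint : IntervalIntegrable (fun r : ℝ => (t - r) ^ (-β)) volume 0 t := by
    have := (intervalIntegral.intervalIntegrable_rpow' (a := 0) (b := t) (r := -β)
      (by linarith)).comp_sub_left t
    simpa using this.symm
  have hint' := (intervalIntegrable_iff_integrableOn_Ioc_of_le ht.le).mp hint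
  have hval : ∫ r in Set.Ioc (0 : ℝ) t, (t - r) ^ (-β) = t ^ (1 - β) / (1 - β) := by
    rw [← intervalIntegral.integral_of_le ht.le,
      intervalIntegral.integral_comp_sub_left (fun r : ℝ => r ^ (-β)) t,
      integral_rpow (Or.inl (by linarith)), sub_self, sub_zero,
      Real.zero_rpow (by linarith), sub_zero, neg_add_eq_sub]
  have hmono := integral_mono_of_nonneg (μ := volume.restrict (Set.Ioc (0 : ℝ) t))
    (f := fun r : ℝ => ∫ z : ℝ, (greenG β (t - r) (x - z) - greenG β (t - r) (y - z)) ^ 2)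
    (Filter.Eventually.of_forall fun r => integral_nonneg fun z => sq_nonneg _)
    (hint'.const_mul (K * |x - y|))
    (by
      have hne : ∀ᵐ r : ℝ ∂(volume.restrict (Set.Ioc (0 : ℝ) t)), r ≠ t :=
        ae_restrict_of_ae (Measure.ae_ne volume t)
      filter_upwards [ae_restrict_mem measurableSet_Ioc, hne] with r hr hrt
      exact H (t - r) (sub_pos.mpr (lt_of_le_of_ne hr.2 hrt)) x y)
  refine hmono.trans_eq ?_
  rw [integral_const_mul, hval]
  ring
end

section
/- Let β ∈ (0,1). There exists a finite constant C = C(β) > 0 such that for all 0 < s ≤ t and all x ∈ ℝ: (a) ∫_0^s ∫_ℝ (G_β(t−r, x−z) − G_β(s−r, x−z))² dz dr ≤ C · (t−s)^{1−β/2}; and (b) ∫_s^t ∫_ℝ G_β(t−r, x−z)² dz dr ≤ C · (t−s)^{1−β/2}. -/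
open MeasureTheory

/-- The oscillating kernel `Im (ω exp(-u ω))`, `ω = exp(iπl)`. -/
noncomputable def kerK (l u : ℝ) : ℝ :=
  (Complex.exp ((Real.pi * l : ℝ) * Complex.I) *
    Complex.exp (-(u : ℂ) * Complex.exp ((Real.pi * l : ℝ) * Complex.I))).im

lemma kerK_hasSum (l u : ℝ) :
    HasSum (fun n : ℕ => (-u) ^ n / (n.factorial : ℝ) * Real.sin (Real.pi * (((n : ℝ) + 1) * l)))
      (kerK l u) := by
  have h := NormedSpace.expSeries_div_hasSum_exp (𝔸 := ℂ)
    (-(u : ℂ) * Complex.exp ((Real.pi * l : ℝ) * Complex.I))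
  rw [← Complex.exp_eq_exp_ℂ] at h
  have h2 := Complex.hasSum_im (h.mul_left (Complex.exp ((Real.pi * l : ℝ) * Complex.I)))
  refine h2.congr_fun ?_ |> fun h => h
  intro n
  have : Complex.exp ((Real.pi * l : ℝ) * Complex.I) *
      ((-(u : ℂ) * Complex.exp ((Real.pi * l : ℝ) * Complex.I)) ^ n / (n.factorial : ℂ))
      = (((-u) ^ n / (n.factorial : ℝ) : ℝ) : ℂ) *
        Complex.exp ((Real.pi * (((n : ℝ) + 1) * l) : ℝ) * Complex.I) := by
    rw [mul_pow, ← Complex.exp_nat_mul]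
    have e : Complex.exp ((Real.pi * (((n : ℝ) + 1) * l) : ℝ) * Complex.I) =
        Complex.exp ((Real.pi * l : ℝ) * Complex.I) *
          Complex.exp (n * ((Real.pi * l : ℝ) * Complex.I)) := by
      rw [← Complex.exp_add]; congr 1; push_cast; ring
    rw [e]; push_cast; ring
  rw [this, Complex.im_ofReal_mul, Complex.exp_ofReal_mul_I_im]

lemma kerK_abs_le (l u : ℝ) : |kerK l u| ≤ Real.exp (-(u * Real.cos (Real.pi * l))) := by
  unfold kerK
  refine (Complex.abs_im_le_norm _).trans ?_
  rw [norm_mul, Complex.norm_exp_ofReal_mul_I, one_mul, Complex.norm_exp]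
  apply le_of_eq
  congr 1
  rw [← Complex.ofReal_neg, Complex.re_ofReal_mul, Complex.exp_ofReal_mul_I_re]
  ring

lemma kerK_measurable (l : ℝ) : Measurable (kerK l) := by
  have : Continuous (kerK l) := by unfold kerK; fun_prop
  exact this.measurable

lemma cos_pos_l {l : ℝ} (h0 : 0 < l) (h1 : l < 1 / 2) : 0 < Real.cos (Real.pi * l) := by
  apply Real.cos_pos_of_mem_Ioo
  constructor <;> nlinarith [Real.pi_pos]

lemma integrable_aux {l τ y : ℝ} (h0 : 0 < l) (h1 : l < 1 / 2) (hτ : 0 < τ) (hy : 0 ≤ y) :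
    IntegrableOn (fun r : ℝ => r ^ (l - 1) * Real.exp (-(τ * r)) * Real.exp (y * r ^ l))
      (Set.Ioi 0) := by
  have hI : IntegrableOn (fun r : ℝ => Real.exp (y + y ^ 2 / (2 * τ)) *
      (r ^ (l - 1) * Real.exp (-(τ / 2) * r ^ (1 : ℝ)))) (Set.Ioi 0) :=
    (integrableOn_rpow_mul_exp_neg_mul_rpow (by linarith) one_pos (by positivity)).const_mul _
  refine Integrable.mono' hI ?_ ?_
  · exact (by fun_prop : Measurable _).aestronglyMeasurable
  · filter_upwards [ae_restrict_mem measurableSet_Ioi] with r hr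
    have hr : 0 < r := hr
    rw [Real.norm_of_nonneg (by positivity), Real.rpow_one]
    have key : r ^ l ≤ 1 + r ^ (1 / 2 : ℝ) := by
      rcases le_total r 1 with h | h
      · have := Real.rpow_le_one hr.le h h0.le
        have : 0 ≤ r ^ (1 / 2 : ℝ) := by positivity
        linarith
      · have := Real.rpow_le_rpow_of_exponent_le h h1.le
        linarith
    have hs : r ^ (1 / 2 : ℝ) * r ^ (1 / 2 : ℝ) = r := by
      rw [← Real.rpow_add hr]; norm_num
    set q := r ^ (1 / 2 : ℝ)
    have h3 : y * q ≤ y ^ 2 / (2 * τ) + τ / 2 * r := by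
      have : y ^ 2 / (2 * τ) + τ / 2 * r - y * q = (y - τ * q) ^ 2 / (2 * τ) := by
        rw [← hs]; field_simp; ring
      have : 0 ≤ (y - τ * q) ^ 2 / (2 * τ) := by positivity
      linarith
    have h4 : y * r ^ l ≤ y * (1 + q) := mul_le_mul_of_nonneg_left key hy
    rw [mul_assoc, ← Real.exp_add, mul_left_comm, ← Real.exp_add]
    refine mul_le_mul_of_nonneg_left (Real.exp_le_exp.mpr ?_) (by positivity)
    linarith

lemma greenG_eq {β τ x : ℝ} (hβ0 : 0 < β) (hβ1 : β < 1) (hτ : 0 < τ) :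
    greenG β τ x = 1 / (2 * Real.pi) * ∫ r in Set.Ioi (0 : ℝ),
      r ^ (β / 2 - 1) * Real.exp (-(τ * r)) * kerK (β / 2) (|x| * r ^ (β / 2)) := by
  have hc : ⌈β⌉₊ = 1 := by
    rw [Nat.ceil_eq_iff one_ne_zero]; constructor <;> norm_num <;> linarith
  unfold greenG mainardiR
  rw [hc]
  set l := β / 2 with hl
  have h0 : 0 < l := by positivity
  have h1 : l < 1 / 2 := by linarith
  set y := |x| with hy
  have hy0 : 0 ≤ y := abs_nonneg x
  have hpt : ∀ r : ℝ, 0 < r → ∀ n : ℕ, r ^ (l - 1) * (y * r ^ l) ^ n =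
      y ^ n * r ^ (((n : ℝ) + 1) * l - 1) := by
    intro r hr n
    rw [mul_pow, ← Real.rpow_natCast (r ^ l), ← Real.rpow_mul hr.le, mul_left_comm,
      ← Real.rpow_add hr]
    congr 2; ring
  have hsum := hasSum_integral_of_dominated_convergence (μ := volume.restrict (Set.Ioi (0 : ℝ)))
    (F := fun (n : ℕ) r => r ^ (l - 1) * Real.exp (-(τ * r)) *
      ((-(y * r ^ l)) ^ n / (n.factorial : ℝ) * Real.sin (Real.pi * (((n : ℝ) + 1) * l))))
    (f := fun r => r ^ (l - 1) * Real.exp (-(τ * r)) * kerK l (y * r ^ l))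
    (bound := fun n r => r ^ (l - 1) * Real.exp (-(τ * r)) * ((y * r ^ l) ^ n / (n.factorial : ℝ)))
    ?_ ?_ ?_ ?_ ?_
  · rw [← hsum.tsum_eq, ← tsum_mul_left, ← tsum_mul_left]
    congr 1
    ext n
    have hint : (∫ r in Set.Ioi (0 : ℝ), r ^ (l - 1) * Real.exp (-(τ * r)) *
      ((-(y * r ^ l)) ^ n / (n.factorial : ℝ) * Real.sin (Real.pi * (((n : ℝ) + 1) * l))))
      = ((-y) ^ n / (n.factorial : ℝ) * Real.sin (Real.pi * (((n : ℝ) + 1) * l))) *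
        ((1 / τ) ^ (((n : ℝ) + 1) * l) * Real.Gamma (((n : ℝ) + 1) * l)) := by
      rw [← Real.integral_rpow_mul_exp_neg_mul_Ioi (by positivity) hτ, ← integral_const_mul]
      apply setIntegral_congr_fun measurableSet_Ioi
      intro r hr
      have := hpt r hr n
      simp only
      rw [neg_pow, neg_pow y]
      linear_combination ((-1) ^ n * Real.exp (-(τ * r)) / (n.factorial : ℝ) *
        Real.sin (Real.pi * (((n : ℝ) + 1) * l))) * this
    rw [hint]
    have hrefl := Real.Gamma_mul_Gamma_one_sub (((n : ℝ) + 1) * l)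
    set a := ((n : ℝ) + 1) * l with ha
    have ha0 : 0 < a := by positivity
    have hG : (Real.Gamma (1 - a))⁻¹ = Real.Gamma a * Real.sin (Real.pi * a) / Real.pi := by
      have hGa := (Real.Gamma_pos_of_pos ha0).ne'
      have : Real.Gamma (1 - a) = (Real.pi / Real.sin (Real.pi * a)) / Real.Gamma a := by
        rw [← hrefl]; field_simp
      rw [this, inv_div, div_div_eq_mul_div]
    have hp : τ ^ ((1 : ℕ) - 1 - l : ℝ) * (-(y / τ ^ l)) ^ n = (-y) ^ n * (1 / τ) ^ a := by
      rw [neg_pow, neg_pow y, div_pow, ← Real.rpow_natCast (τ ^ l), ← Real.rpow_mul hτ.le,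
        one_div, Real.inv_rpow hτ.le, ← Real.rpow_neg hτ.le]
      rw [div_eq_mul_inv, ← Real.rpow_neg hτ.le]
      have : τ ^ (-a) = τ ^ ((1 : ℕ) - 1 - l : ℝ) * τ ^ (-(l * n)) := by
        rw [← Real.rpow_add hτ]; congr 1; rw [ha]; push_cast; ring
      rw [this]; ring
    have hd : ∀ A : ℝ, A / ((n.factorial : ℝ) * Real.Gamma (1 - a)) =
        A / (n.factorial : ℝ) * (Real.Gamma (1 - a))⁻¹ := by
      intro A; rw [div_mul_eq_div_div, div_eq_mul_inv (A / _)]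
    rw [Nat.cast_one] at hp ⊢
    rw [hd, hG]
    have : Real.pi ≠ 0 := Real.pi_ne_zero
    linear_combination (1 / (2 * Real.pi) * Real.Gamma a * Real.sin (Real.pi * a) /
      (n.factorial : ℝ)) * hp
  · intro n
    exact (by fun_prop : Measurable _).aestronglyMeasurable
  · intro n
    filter_upwards [ae_restrict_mem measurableSet_Ioi] with r hr
    have hr : 0 < r := hr
    have hu : 0 ≤ y * r ^ l := by positivity
    rw [norm_mul, norm_mul, norm_mul, norm_div, norm_pow, norm_neg,
      Real.norm_of_nonneg hu, Real.norm_of_nonneg (by positivity : 0 ≤ r ^ (l - 1)),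
      Real.norm_of_nonneg (Real.exp_pos _).le, Real.norm_natCast]
    refine mul_le_mul_of_nonneg_left ?_ (by positivity)
    refine mul_le_of_le_one_right (by positivity) ?_
    exact Real.abs_sin_le_one _
  · filter_upwards with r
    exact (Real.summable_pow_div_factorial _).mul_left _
  · refine (integrable_aux h0 h1 hτ hy0).congr ?_
    filter_upwards with r
    rw [tsum_mul_left]
    congr 1
    rw [Real.exp_eq_exp_ℝ, NormedSpace.exp_eq_tsum_div]
  · filter_upwards with r
    exact (kerK_hasSum l _).mul_left _

lemma integrable_ker {l τ y : ℝ} (h0 : 0 < l) (h1 : l < 1 / 2) (hτ : 0 < τ) (hy : 0 ≤ y) :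
    IntegrableOn (fun r : ℝ => r ^ (l - 1) * Real.exp (-(τ * r)) * kerK l (y * r ^ l))
      (Set.Ioi 0) := by
  refine Integrable.mono' (integrable_aux h0 h1 hτ le_rfl) ?_ ?_
  · have := (kerK_measurable l)
    exact (by fun_prop : Measurable _).aestronglyMeasurable
  · filter_upwards [ae_restrict_mem measurableSet_Ioi] with r hr
    have hr : 0 < r := hr
    rw [norm_mul, Real.norm_of_nonneg (by positivity), zero_mul, Real.exp_zero]
    refine mul_le_mul_of_nonneg_left ((kerK_abs_le l _).trans ?_) (by positivity)
    rw [Real.exp_le_one_iff]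
    have := cos_pos_l h0 h1
    have : 0 ≤ y * r ^ l * Real.cos (Real.pi * l) := by positivity
    linarith

lemma diff_le {β τ h x : ℝ} (hβ0 : 0 < β) (hβ1 : β < 1) (hτ : 0 < τ) (hh : 0 ≤ h) :
    ‖greenG β (τ + h) x - greenG β τ x‖ₑ ≤ ∫⁻ r in Set.Ioi (0 : ℝ),
      ENNReal.ofReal (r ^ (β / 2 - 1) * (1 - Real.exp (-(h * r))) * (Real.exp (-(τ * r)) *
        Real.exp (-(|x| * r ^ (β / 2) * Real.cos (Real.pi * (β / 2)))))) := by
  have h0 : 0 < β / 2 := by positivity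
  have h1 : β / 2 < 1 / 2 := by linarith
  rw [greenG_eq hβ0 hβ1 hτ, greenG_eq hβ0 hβ1 (by linarith : 0 < τ + h), ← mul_sub,
    ← integral_sub (integrable_ker h0 h1 (by linarith) (abs_nonneg x))
      (integrable_ker h0 h1 hτ (abs_nonneg x)), enorm_mul]
  have hp : ‖1 / (2 * Real.pi)‖ₑ ≤ 1 := by
    rw [Real.enorm_eq_ofReal (by positivity), ENNReal.ofReal_le_one, div_le_one (by positivity)]
    linarith [Real.pi_gt_three]
  refine (mul_le_of_le_one_left zero_le hp).trans ?_
  refine (enorm_integral_le_lintegral_enorm _).trans ?_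
  refine setLIntegral_mono_ae' measurableSet_Ioi (Filter.Eventually.of_forall ?_)
  intro r hr
  have hr : 0 < r := hr
  rw [← ofReal_norm]
  apply ENNReal.ofReal_le_ofReal
  have hm : 0 ≤ 1 - Real.exp (-(h * r)) := by
    rw [sub_nonneg, Real.exp_le_one_iff]; have : 0 ≤ h * r := by positivity
    linarith
  have : r ^ (β / 2 - 1) * Real.exp (-((τ + h) * r)) * kerK (β / 2) (|x| * r ^ (β / 2)) -
      r ^ (β / 2 - 1) * Real.exp (-(τ * r)) * kerK (β / 2) (|x| * r ^ (β / 2)) =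
      -((r ^ (β / 2 - 1) * (1 - Real.exp (-(h * r))) * Real.exp (-(τ * r))) *
        kerK (β / 2) (|x| * r ^ (β / 2))) := by
    have : Real.exp (-((τ + h) * r)) = Real.exp (-(τ * r)) * Real.exp (-(h * r)) := by
      rw [← Real.exp_add]; congr 1; ring
    rw [this]; ring
  rw [this, norm_neg, norm_mul, Real.norm_of_nonneg (by positivity), ← mul_assoc]
  exact mul_le_mul_of_nonneg_left (kerK_abs_le _ _) (by positivity)

lemma cs_lint {α : Type*} [MeasurableSpace α] (μ : Measure α) {f g : α → ENNReal}
    (hf : AEMeasurable f μ) (hg : AEMeasurable g μ) :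
    (∫⁻ a, f a * g a ∂μ) ^ 2 ≤ (∫⁻ a, f a ^ 2 ∂μ) * ∫⁻ a, g a ^ 2 ∂μ := by
  have h := ENNReal.lintegral_mul_le_Lp_mul_Lq μ Real.HolderConjugate.two_two hf hg
  simp only [Pi.mul_apply, ENNReal.rpow_two] at h
  calc _ ≤ ((∫⁻ a, f a ^ 2 ∂μ) ^ (1 / 2 : ℝ) * (∫⁻ a, g a ^ 2 ∂μ) ^ (1 / 2 : ℝ)) ^ 2 := by
        gcongr
    _ = _ := by
        rw [mul_pow, ← ENNReal.rpow_two, ← ENNReal.rpow_two, ← ENNReal.rpow_mul,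
          ← ENNReal.rpow_mul]
        norm_num

lemma lint_exp_abs {b : ℝ} (hb : 0 < b) :
    ∫⁻ z : ℝ, ENNReal.ofReal (Real.exp (-(b * |z|))) = ENNReal.ofReal (2 / b) := by
  have h : ∫ z : ℝ, Real.exp (-(b * |z|)) = 2 / b := by
    rw [integral_comp_abs (f := fun z => Real.exp (-(b * z)))]
    have := integral_exp_mul_Ioi (a := -b) (by linarith) 0
    simp only [neg_mul] at this
    rw [this]; simp; field_simp
  have hi : Integrable (fun z : ℝ => Real.exp (-(b * |z|))) := by
    apply Integrable.of_integral_ne_zero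
    rw [h]; positivity
  rw [← h, ofReal_integral_eq_lintegral_ofReal hi
    (Filter.Eventually.of_forall fun z => (Real.exp_pos _).le)]

lemma lint_exp_Ioo {b s : ℝ} (hb : 0 < b) :
    ∫⁻ q in Set.Ioo (0 : ℝ) s, ENNReal.ofReal (Real.exp (-(b * (s - q)))) ≤
      ENNReal.ofReal (1 / b) := by
  have hi := integrableOn_exp_mul_Ioi (a := -b) (by linarith) 0
  have h := integral_exp_mul_Ioi (a := -b) (by linarith) 0
  have h2 := ofReal_integral_eq_lintegral_ofReal hi
    (Filter.Eventually.of_forall fun z => (Real.exp_pos _).le)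
  rw [h] at h2
  have e : -Real.exp (-b * 0) / -b = 1 / b := by simp
  rw [e] at h2
  rw [h2, ← lintegral_indicator measurableSet_Ioi, ← lintegral_indicator measurableSet_Ioo]
  refine le_trans (lintegral_mono ?_) (lintegral_sub_left_eq_self _ s).le
  intro q
  by_cases hq : q ∈ Set.Ioo (0 : ℝ) s
  · have : s - q ∈ Set.Ioi (0 : ℝ) := by simpa using hq.2
    simp only [Set.indicator_of_mem hq, Set.indicator_of_mem this, neg_mul, le_refl]
  · simp only [Set.indicator_of_notMem hq, zero_le]

lemma lint_A {l : ℝ} (h0 : 0 < l) (h1 : l < 1 / 2) {h : ℝ} (hh : 0 < h) :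
    ∫⁻ r in Set.Ioi (0 : ℝ), ENNReal.ofReal ((1 - Real.exp (-(h * r))) * r ^ ((l - 3) / 2)) ≤
      ENNReal.ofReal ((2 / (1 + l) + 2 / (1 - l)) * h ^ ((1 - l) / 2)) := by
  have hd : 0 < 1 / h := by positivity
  rw [← Set.Ioc_union_Ioi_eq_Ioi hd.le, lintegral_union measurableSet_Ioi
    (Set.Ioc_disjoint_Ioi le_rfl), add_mul, ENNReal.ofReal_add
      (by have : 0 < 1 + l := by linarith
          positivity) (by have : 0 < 1 - l := by linarith
                          positivity)]
  apply add_le_add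
  · have hii : IntervalIntegrable (fun r : ℝ => r ^ ((l - 1) / 2)) volume 0 (1 / h) :=
      intervalIntegral.intervalIntegrable_rpow' (by linarith)
    have hi : IntegrableOn (fun r : ℝ => h * r ^ ((l - 1) / 2)) (Set.Ioc 0 (1 / h)) :=
      ((intervalIntegrable_iff_integrableOn_Ioc_of_le hd.le).mp hii).const_mul h
    have hv : ∫ r in Set.Ioc 0 (1 / h), h * r ^ ((l - 1) / 2) =
        2 / (1 + l) * h ^ ((1 - l) / 2) := by
      rw [integral_const_mul, ← intervalIntegral.integral_of_le hd.le,
        integral_rpow (Or.inl (by linarith)), Real.zero_rpow (by linarith), sub_zero, one_div,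
        Real.inv_rpow hh.le, ← Real.rpow_neg hh.le]
      have : h ^ ((1 - l) / 2) = h * h ^ (-((l - 1) / 2 + 1)) := by
        rw [← Real.rpow_one_add' hh.le (by linarith)]; congr 1; ring
      rw [this]
      have : (1 + l) ≠ 0 := by linarith
      have : (l - 1) / 2 + 1 = (1 + l) / 2 := by ring
      rw [this]
      field_simp
    rw [← hv, ofReal_integral_eq_lintegral_ofReal hi (by
      filter_upwards [ae_restrict_mem measurableSet_Ioc] with r hr
      have := hr.1
      simp only [Pi.zero_apply]
      positivity)]
    refine setLIntegral_mono_ae' measurableSet_Ioc (Filter.Eventually.of_forall ?_)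
    intro r hr
    have hr := hr.1
    apply ENNReal.ofReal_le_ofReal
    have : h * r ^ ((l - 1) / 2) = (h * r) * r ^ ((l - 3) / 2) := by
      rw [mul_assoc, ← Real.rpow_one_add' hr.le (by linarith)]; congr 2; ring
    rw [this]
    refine mul_le_mul_of_nonneg_right ?_ (by positivity)
    linarith [Real.add_one_le_exp (-(h * r))]
  · have hi := integrableOn_Ioi_rpow_of_lt (a := (l - 3) / 2) (by linarith) hd
    have hv := integral_Ioi_rpow_of_lt (a := (l - 3) / 2) (by linarith) hd
    have hv' : ∫ r in Set.Ioi (1 / h), r ^ ((l - 3) / 2) = 2 / (1 - l) * h ^ ((1 - l) / 2) := by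
      rw [hv, one_div, Real.inv_rpow hh.le, ← Real.rpow_neg hh.le]
      have : -((l - 3) / 2 + 1) = (1 - l) / 2 := by ring
      rw [this]
      have : (1 - l) ≠ 0 := by linarith
      have : (l - 3) / 2 + 1 = -((1 - l) / 2) := by ring
      rw [this, neg_div_neg_eq]
      field_simp
    rw [← hv', ofReal_integral_eq_lintegral_ofReal hi (by
      filter_upwards [ae_restrict_mem measurableSet_Ioi] with r hr
      have : 0 < r := hd.trans hr
      simp only [Pi.zero_apply]
      positivity)]
    refine setLIntegral_mono_ae' measurableSet_Ioi (Filter.Eventually.of_forall ?_)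
    intro r hr
    have hr : 0 < r := hd.trans hr
    apply ENNReal.ofReal_le_ofReal
    refine mul_le_of_le_one_left (by positivity) ?_
    linarith [Real.exp_pos (-(h * r))]

lemma part_b {β : ℝ} (hβ0 : 0 < β) (hβ1 : β < 1) :
    ∃ K : ℝ, 0 ≤ K ∧ ∀ s t : ℝ, s ≤ t → ∀ x : ℝ,
      (∫ r in Set.Ioc s t, ∫ z : ℝ, greenG β (t - r) (x - z) ^ 2)
          = K * (t - s) ^ (1 - β / 2) := by
  have hc : ⌈β⌉₊ = 1 := by
    rw [Nat.ceil_eq_iff one_ne_zero]; constructor <;> norm_num <;> linarith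
  set J := ∫ z : ℝ, mainardiR (β / 2) 1 |z| ^ 2 with hJ
  have hJ0 : 0 ≤ J := integral_nonneg fun z => sq_nonneg _
  refine ⟨1 / 4 * J / (1 - β / 2), div_nonneg (by positivity) (by linarith), ?_⟩
  intro s t hst x
  have inner : ∀ τ : ℝ, 0 < τ → ∫ z : ℝ, greenG β τ (x - z) ^ 2 = 1 / 4 * J * τ ^ (-(β / 2)) := by
    intro τ hτ
    rw [integral_sub_left_eq_self (fun z => greenG β τ z ^ 2) volume x]
    have hp : 0 < τ ^ (β / 2) := by positivity
    have : ∀ z : ℝ, greenG β τ z ^ 2 = (1 / 4 * (τ ^ (-(β / 2))) ^ 2) *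
        (fun y => mainardiR (β / 2) 1 |y| ^ 2) (z / τ ^ (β / 2)) := by
      intro z
      unfold greenG
      rw [hc]
      simp only [abs_div, abs_of_pos hp, Nat.cast_one, sub_self, zero_sub]
      ring
    rw [integral_congr_ae (Filter.Eventually.of_forall this)]
    rw [integral_const_mul, Measure.integral_comp_div (fun y => mainardiR (β / 2) 1 |y| ^ 2), abs_of_pos hp, smul_eq_mul, ← hJ,
      Real.rpow_neg hτ.le]
    field_simp
  have : (∫ r in Set.Ioc s t, ∫ z : ℝ, greenG β (t - r) (x - z) ^ 2) =
      ∫ r in Set.Ioc s t, 1 / 4 * J * (t - r) ^ (-(β / 2)) := by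
    rw [integral_Ioc_eq_integral_Ioo, integral_Ioc_eq_integral_Ioo]
    apply setIntegral_congr_fun measurableSet_Ioo
    intro r hr
    exact inner (t - r) (by linarith [hr.2])
  rw [this, integral_const_mul, ← intervalIntegral.integral_of_le hst,
    intervalIntegral.integral_comp_sub_left (fun r => r ^ (-(β / 2))) t, sub_self,
    integral_rpow (Or.inl (by linarith)), Real.zero_rpow (by linarith)]
  have : -(β / 2) + 1 = 1 - β / 2 := by ring
  rw [this]
  ring

lemma diff_sq_le {β τ h x : ℝ} (hβ0 : 0 < β) (hβ1 : β < 1) (hτ : 0 < τ) (hh : 0 < h) :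
    ‖(greenG β (τ + h) x - greenG β τ x) ^ 2‖ₑ ≤
      ENNReal.ofReal ((2 / (1 + β / 2) + 2 / (1 - β / 2)) * h ^ ((1 - β / 2) / 2)) *
      ∫⁻ r in Set.Ioi (0 : ℝ),
      ENNReal.ofReal (r ^ (β / 2 - 1) * (1 - Real.exp (-(h * r))) * r ^ ((1 + β / 2) / 2)) *
        ENNReal.ofReal (Real.exp (-(2 * r * τ))) *
        ENNReal.ofReal (Real.exp (-(2 * r ^ (β / 2) * Real.cos (Real.pi * (β / 2)) * |x|))) := by
  have h0 : 0 < β / 2 := by positivity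
  have h1 : β / 2 < 1 / 2 := by linarith
  rw [enorm_pow]
  set l := β / 2 with hl
  set c := Real.cos (Real.pi * l) with hc
  have hm : ∀ r : ℝ, 0 < r → 0 ≤ 1 - Real.exp (-(h * r)) := by
    intro r hr
    rw [sub_nonneg, Real.exp_le_one_iff]; have : 0 ≤ h * r := by positivity
    linarith
  set f : ℝ → ENNReal := fun r => ENNReal.ofReal
    (Real.sqrt ((1 - Real.exp (-(h * r))) * r ^ ((l - 3) / 2))) with hf
  set g : ℝ → ENNReal := fun r => ENNReal.ofReal
    (Real.sqrt (r ^ (l - 1) * (1 - Real.exp (-(h * r))) * r ^ ((1 + l) / 2)) *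
      (Real.exp (-(τ * r)) * Real.exp (-(|x| * r ^ l * c)))) with hg
  have hfm : Measurable f := by rw [hf]; fun_prop
  have hgm : Measurable g := by rw [hg]; fun_prop
  have hD := diff_le (x := x) hβ0 hβ1 hτ hh.le
  have hcs := cs_lint (volume.restrict (Set.Ioi (0 : ℝ))) hfm.aemeasurable hgm.aemeasurable
  have e1 : ∫⁻ r in Set.Ioi (0 : ℝ), f r * g r = ∫⁻ r in Set.Ioi (0 : ℝ),
      ENNReal.ofReal (r ^ (β / 2 - 1) * (1 - Real.exp (-(h * r))) * (Real.exp (-(τ * r)) *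
        Real.exp (-(|x| * r ^ (β / 2) * Real.cos (Real.pi * (β / 2)))))) := by
    apply setLIntegral_congr_fun measurableSet_Ioi
    intro r hr
    have hr : 0 < r := hr
    have hmr := hm r hr
    simp only [hf, hg]
    rw [← ENNReal.ofReal_mul (by positivity), ← mul_assoc, ← Real.sqrt_mul (by positivity)]
    congr 2
    rw [Real.sqrt_eq_iff_mul_self_eq (by positivity) (by positivity)]
    have : r ^ ((l - 3) / 2) * r ^ ((1 + l) / 2) = r ^ (l - 1) := by
      rw [← Real.rpow_add hr]; congr 1; ring
    linear_combination (r ^ (l - 1) * (1 - Real.exp (-(h * r))) ^ 2) * this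
  have e2 : ∫⁻ r in Set.Ioi (0 : ℝ), f r ^ 2 = ∫⁻ r in Set.Ioi (0 : ℝ),
      ENNReal.ofReal ((1 - Real.exp (-(h * r))) * r ^ ((l - 3) / 2)) := by
    apply setLIntegral_congr_fun measurableSet_Ioi
    intro r hr
    have hr : 0 < r := hr
    have hmr := hm r hr
    simp only [hf]
    rw [← ENNReal.ofReal_pow (by positivity), Real.sq_sqrt (by positivity)]
  have e3 : ∫⁻ r in Set.Ioi (0 : ℝ), g r ^ 2 = ∫⁻ r in Set.Ioi (0 : ℝ),
      ENNReal.ofReal (r ^ (l - 1) * (1 - Real.exp (-(h * r))) * r ^ ((1 + l) / 2)) *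
        ENNReal.ofReal (Real.exp (-(2 * r * τ))) *
        ENNReal.ofReal (Real.exp (-(2 * r ^ l * c * |x|))) := by
    apply setLIntegral_congr_fun measurableSet_Ioi
    intro r hr
    have hr : 0 < r := hr
    have hmr := hm r hr
    simp only [hg]
    rw [← ENNReal.ofReal_pow (by positivity), ← ENNReal.ofReal_mul (by positivity),
      ← ENNReal.ofReal_mul (by positivity), mul_pow, Real.sq_sqrt (by positivity),
      ← Real.exp_add, ← Real.exp_nat_mul, mul_assoc _ (Real.exp _), ← Real.exp_add]
    congr 3
    push_cast
    ring
  rw [e1, e2, e3] at hcs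
  calc _ ≤ _ := pow_le_pow_left' hD 2
    _ ≤ _ := hcs
    _ ≤ _ := mul_le_mul_left (lint_A h0 h1 hh) _

lemma part_a {β : ℝ} (hβ0 : 0 < β) (hβ1 : β < 1) :
    ∃ K : ℝ, 0 ≤ K ∧ ∀ s t : ℝ, 0 < s → s ≤ t → ∀ x : ℝ,
      (∫ r in Set.Ioc (0 : ℝ) s, ∫ z : ℝ,
            (greenG β (t - r) (x - z) - greenG β (s - r) (x - z)) ^ 2)
          ≤ K * (t - s) ^ (1 - β / 2) := by
  have h0 : 0 < β / 2 := by positivity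
  have h1 : β / 2 < 1 / 2 := by linarith
  have hc := cos_pos_l h0 h1
  set K0 := 2 / (1 + β / 2) + 2 / (1 - β / 2) with hK0
  have hK0p : 0 < K0 := by
    have : 0 < 1 - β / 2 := by linarith
    positivity
  refine ⟨1 / (2 * Real.cos (Real.pi * (β / 2))) * K0 ^ 2, by positivity, ?_⟩
  intro s t hs hst x
  rcases hst.eq_or_lt with rfl | hst
  · simp only [sub_self]
    rw [Real.zero_rpow (by linarith)]
    simp
  have hh : 0 < t - s := by linarith
  set h := t - s with hhd
  have hB0 : 0 ≤ K0 * h ^ ((1 - β / 2) / 2) := by positivity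
  set B := ENNReal.ofReal (K0 * h ^ ((1 - β / 2) / 2)) with hB
  have hBt : B ≠ ⊤ := ENNReal.ofReal_ne_top
  set l := β / 2 with hl
  set c := Real.cos (Real.pi * l) with hcd
  have hm : ∀ r : ℝ, 0 < r → 0 ≤ 1 - Real.exp (-(h * r)) := by
    intro r hr
    rw [sub_nonneg, Real.exp_le_one_iff]; have : 0 ≤ h * r := by positivity
    linarith
  have main : ‖∫ r in Set.Ioc (0 : ℝ) s, ∫ z : ℝ,
            (greenG β (t - r) (x - z) - greenG β (s - r) (x - z)) ^ 2‖ₑ ≤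
      ENNReal.ofReal (1 / (2 * c) * K0 ^ 2 * h ^ (1 - l)) := by
    rw [integral_Ioc_eq_integral_Ioo]
    calc _ ≤ ∫⁻ q in Set.Ioo (0 : ℝ) s, ‖∫ z : ℝ,
            (greenG β (t - q) (x - z) - greenG β (s - q) (x - z)) ^ 2‖ₑ :=
          enorm_integral_le_lintegral_enorm _
      _ ≤ ∫⁻ q in Set.Ioo (0 : ℝ) s, B * ∫⁻ r in Set.Ioi (0 : ℝ),
            ENNReal.ofReal (r ^ (l - 1) * (1 - Real.exp (-(h * r))) * r ^ ((1 + l) / 2)) *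
            ENNReal.ofReal (Real.exp (-(2 * r * (s - q)))) *
            ENNReal.ofReal (2 / (2 * r ^ l * c)) := by
          refine setLIntegral_mono_ae' measurableSet_Ioo (Filter.Eventually.of_forall ?_)
          intro q hq
          have hτ : 0 < s - q := by linarith [hq.2]
          have htq : t - q = (s - q) + h := by rw [hhd]; ring
          rw [htq]
          calc _ ≤ ∫⁻ z : ℝ, ‖(greenG β (s - q + h) (x - z) - greenG β (s - q) (x - z)) ^ 2‖ₑ :=
                enorm_integral_le_lintegral_enorm _
            _ ≤ ∫⁻ z : ℝ, B * ∫⁻ r in Set.Ioi (0 : ℝ),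
                ENNReal.ofReal (r ^ (l - 1) * (1 - Real.exp (-(h * r))) * r ^ ((1 + l) / 2)) *
                ENNReal.ofReal (Real.exp (-(2 * r * (s - q)))) *
                ENNReal.ofReal (Real.exp (-(2 * r ^ l * c * |x - z|))) :=
                lintegral_mono fun z => diff_sq_le hβ0 hβ1 hτ hh
            _ = B * ∫⁻ z : ℝ, ∫⁻ r in Set.Ioi (0 : ℝ),
                ENNReal.ofReal (r ^ (l - 1) * (1 - Real.exp (-(h * r))) * r ^ ((1 + l) / 2)) *
                ENNReal.ofReal (Real.exp (-(2 * r * (s - q)))) *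
                ENNReal.ofReal (Real.exp (-(2 * r ^ l * c * |x - z|))) :=
                lintegral_const_mul' _ _ hBt
            _ = B * ∫⁻ r in Set.Ioi (0 : ℝ), ∫⁻ z : ℝ,
                ENNReal.ofReal (r ^ (l - 1) * (1 - Real.exp (-(h * r))) * r ^ ((1 + l) / 2)) *
                ENNReal.ofReal (Real.exp (-(2 * r * (s - q)))) *
                ENNReal.ofReal (Real.exp (-(2 * r ^ l * c * |x - z|))) := by
                rw [lintegral_lintegral_swap]
                apply Measurable.aemeasurable
                unfold Function.uncurry
                have habs : Measurable (fun p : ℝ × ℝ => |x - p.1|) :=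
                  (by fun_prop : Continuous (fun p : ℝ × ℝ => |x - p.1|)).measurable
                fun_prop
            _ = _ := by
                congr 1
                apply setLIntegral_congr_fun measurableSet_Ioi
                intro r hr
                have hr : 0 < r := hr
                simp only
                rw [lintegral_const_mul' _ _
                  (ENNReal.mul_ne_top ENNReal.ofReal_ne_top ENNReal.ofReal_ne_top),
                  lintegral_sub_left_eq_self
                  (fun z => ENNReal.ofReal (Real.exp (-(2 * r ^ l * c * |z|)))) x,
                  lint_exp_abs (by positivity)]
      _ = B * ∫⁻ q in Set.Ioo (0 : ℝ) s, ∫⁻ r in Set.Ioi (0 : ℝ),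
            ENNReal.ofReal (r ^ (l - 1) * (1 - Real.exp (-(h * r))) * r ^ ((1 + l) / 2)) *
            ENNReal.ofReal (Real.exp (-(2 * r * (s - q)))) *
            ENNReal.ofReal (2 / (2 * r ^ l * c)) := lintegral_const_mul' _ _ hBt
      _ = B * ∫⁻ r in Set.Ioi (0 : ℝ), ∫⁻ q in Set.Ioo (0 : ℝ) s,
            ENNReal.ofReal (r ^ (l - 1) * (1 - Real.exp (-(h * r))) * r ^ ((1 + l) / 2)) *
            ENNReal.ofReal (Real.exp (-(2 * r * (s - q)))) *
            ENNReal.ofReal (2 / (2 * r ^ l * c)) := by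
            rw [lintegral_lintegral_swap]
            apply Measurable.aemeasurable
            unfold Function.uncurry
            fun_prop
      _ ≤ B * ∫⁻ r in Set.Ioi (0 : ℝ), ENNReal.ofReal (1 / (2 * c)) *
            ENNReal.ofReal ((1 - Real.exp (-(h * r))) * r ^ ((l - 3) / 2)) := by
            refine mul_le_mul_right ?_ _
            refine setLIntegral_mono_ae' measurableSet_Ioi (Filter.Eventually.of_forall ?_)
            intro r hr
            have hr : 0 < r := hr
            have hmr := hm r hr
            rw [lintegral_mul_const' _ _ ENNReal.ofReal_ne_top,
              lintegral_const_mul' _ _ ENNReal.ofReal_ne_top]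
            calc _ ≤ ENNReal.ofReal (r ^ (l - 1) * (1 - Real.exp (-(h * r))) * r ^ ((1 + l) / 2)) *
                  ENNReal.ofReal (1 / (2 * r)) * ENNReal.ofReal (2 / (2 * r ^ l * c)) := by
                  gcongr
                  exact lint_exp_Ioo (by positivity)
              _ = _ := by
                  rw [← ENNReal.ofReal_mul (by positivity), ← ENNReal.ofReal_mul (by positivity),
                    ← ENNReal.ofReal_mul (by positivity)]
                  congr 1
                  have : r ^ (l - 1) * r ^ ((1 + l) / 2) = r ^ ((l - 3) / 2) * r * r ^ l := by
                    rw [← Real.rpow_add hr, ← Real.rpow_add_one hr.ne', ← Real.rpow_add hr]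
                    congr 1; ring
                  have hrl : r ^ l ≠ 0 := by positivity
                  field_simp
                  linear_combination (1 - Real.exp (-(h * r))) * this
      _ = B * (ENNReal.ofReal (1 / (2 * c)) * ∫⁻ r in Set.Ioi (0 : ℝ),
            ENNReal.ofReal ((1 - Real.exp (-(h * r))) * r ^ ((l - 3) / 2))) := by
            rw [lintegral_const_mul' _ _ ENNReal.ofReal_ne_top]
      _ ≤ B * (ENNReal.ofReal (1 / (2 * c)) * B) := by
            gcongr
            exact lint_A h0 h1 hh
      _ = _ := by
            rw [hB, ← ENNReal.ofReal_mul (by positivity), ← ENNReal.ofReal_mul (by positivity)]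
            congr 1
            have : h ^ (1 - l) = h ^ ((1 - l) / 2) * h ^ ((1 - l) / 2) := by
              rw [← Real.rpow_add hh]; congr 1; ring
            rw [this]; ring
  rw [← ofReal_norm, ENNReal.ofReal_le_ofReal_iff (by positivity)] at main
  exact (Real.le_norm_self _).trans main

/-- for `β ∈ (0,1)` there is a finite constant `C = C(β) > 0` such that for
all `0 < s ≤ t` and `x ∈ ℝ`:
(a) `∫_0^s ∫_ℝ (G_β(t−r,x−z) − G_β(s−r,x−z))² dz dr ≤ C (t−s)^{1−β/2}`; and
(b) `∫_s^t ∫_ℝ G_β(t−r,x−z)² dz dr ≤ C (t−s)^{1−β/2}`. -/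
theorem greenG_time_increment (β : ℝ) (hβ0 : 0 < β) (hβ1 : β < 1) :
    ∃ C : ℝ, 0 < C ∧
      ∀ s t : ℝ, 0 < s → s ≤ t → ∀ x : ℝ,
        ((∫ r in Set.Ioc (0 : ℝ) s, ∫ z : ℝ,
            (greenG β (t - r) (x - z) - greenG β (s - r) (x - z)) ^ 2)
          ≤ C * (t - s) ^ (1 - β / 2)) ∧
        ((∫ r in Set.Ioc s t, ∫ z : ℝ, greenG β (t - r) (x - z) ^ 2)
          ≤ C * (t - s) ^ (1 - β / 2)) := by
  obtain ⟨K, hK, ha⟩ := part_a hβ0 hβ1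
  obtain ⟨L, hL, hb⟩ := part_b hβ0 hβ1
  refine ⟨K + L + 1, by positivity, ?_⟩
  intro s t hs hst x
  have hp : 0 ≤ (t - s) ^ (1 - β / 2) := Real.rpow_nonneg (by linarith) _
  refine ⟨(ha s t hs hst x).trans (mul_le_mul_of_nonneg_right (by linarith) hp), ?_⟩
  rw [hb s t hst x]
  exact mul_le_mul_of_nonneg_right (by linarith) hp
end
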